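/- For every T > 0, M ≥ 1, ε ∈ (0,1], every real p with 1 ≤ p < ∞ and every real n with n ≥ p, there exists a constant C > 0, depending only on M, ε, T, n and p, such that every smooth solution (v,u,θ,q) of the radiation hydrodynamics system on [0,T] with (M,ε)-bounded initial data satisfies ∫₀ᵗ ‖θ(s,·)‖_{L^∞}^p ds ≤ C(1 + 𝔜(t)^{𝔗₀(n,p,β)}) for all t ∈ [0,T]. -/

import Mathlib

open MeasureTheory Real Set

noncomputable section

namespace RadHydro

/-- Integral over one period `[-1/2, 1/2]` of the torus `𝕋 ≅ ℝ/ℤ`. -/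
def tInt (f : ℝ → ℝ) : ℝ := ∫ x in (-(1/2) : ℝ)..(1/2 : ℝ), f x

/-- Squared `L²` norm over the torus. -/
def L2sq (f : ℝ → ℝ) : ℝ := tInt fun x => (f x) ^ 2

/-- `L^∞` norm over the torus. -/
def Linf (f : ℝ → ℝ) : ℝ := sSup ((fun x => |f x|) '' Icc (-(1/2) : ℝ) (1/2))

/-- Squared `H¹` norm over the torus. -/
def H1sq (f : ℝ → ℝ) : ℝ := L2sq f + L2sq (deriv f)

/-- Squared `H²` norm over the torus. -/
def H2sq (f : ℝ → ℝ) : ℝ := L2sq f + L2sq (deriv f) + L2sq (deriv (deriv f))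

/-- Partial derivative in the time variable. -/
def pt (f : ℝ → ℝ → ℝ) (t x : ℝ) : ℝ := deriv (fun s => f s x) t

/-- Partial derivative in the space variable. -/
def px (f : ℝ → ℝ → ℝ) (t x : ℝ) : ℝ := deriv (f t) x

/-- The heat conductivity `κ(v, θ) = κ₁ + κ₂ v θ^β`. -/
def kappa (κ₁ κ₂ β v θ : ℝ) : ℝ := κ₁ + κ₂ * v * θ ^ β

/-- A smooth solution of the radiation hydrodynamics system (in Lagrangian
coordinates) on `[0, T]`: four `C^∞` functions on `[0,T] × ℝ` (modelled as smooth
functions on all of `ℝ × ℝ`), `1`-periodic in the space variable, with `v > 0`,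
`θ > 0`, satisfying the four equations pointwise for `t ∈ [0, T]`, and with the
normalization `∫_𝕋 v(0, x) dx = 1`. -/
structure Sol (μ R a b κ₁ κ₂ β γ T : ℝ) where
  v : ℝ → ℝ → ℝ
  u : ℝ → ℝ → ℝ
  θ : ℝ → ℝ → ℝ
  q : ℝ → ℝ → ℝ
  smooth_v : ContDiff ℝ (⊤ : ℕ∞) fun p : ℝ × ℝ => v p.1 p.2
  smooth_u : ContDiff ℝ (⊤ : ℕ∞) fun p : ℝ × ℝ => u p.1 p.2
  smooth_θ : ContDiff ℝ (⊤ : ℕ∞) fun p : ℝ × ℝ => θ p.1 p.2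
  smooth_q : ContDiff ℝ (⊤ : ℕ∞) fun p : ℝ × ℝ => q p.1 p.2
  periodic_v : ∀ t, Function.Periodic (v t) 1
  periodic_u : ∀ t, Function.Periodic (u t) 1
  periodic_θ : ∀ t, Function.Periodic (θ t) 1
  periodic_q : ∀ t, Function.Periodic (q t) 1
  v_pos : ∀ t x, 0 < v t x
  θ_pos : ∀ t x, 0 < θ t x
  eq_mass : ∀ t ∈ Icc (0 : ℝ) T, ∀ x : ℝ, pt v t x - px u t x = 0
  eq_mom : ∀ t ∈ Icc (0 : ℝ) T, ∀ x : ℝ,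
    pt u t x + px (fun s y => R * θ s y / v s y) t x
      = px (fun s y => μ * px u s y / v s y) t x
  eq_energy : ∀ t ∈ Icc (0 : ℝ) T, ∀ x : ℝ,
    pt (fun s y => R / (γ - 1) * θ s y + (u s y) ^ 2 / 2) t x
      + px (fun s y => R * θ s y / v s y * u s y) t x + px q t x
      = px (fun s y => μ * u s y * px u s y / v s y) t x
        + px (fun s y => kappa κ₁ κ₂ β (v s y) (θ s y) * px θ s y / v s y) t x
  eq_rad : ∀ t ∈ Icc (0 : ℝ) T, ∀ x : ℝ,
    -px (fun s y => px q s y / v s y) t x + a * v t x * q t x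
      + b * px (fun s y => (θ s y) ^ 4) t x = 0
  mean_v : tInt (v 0) = 1

/-- `(M, ε)`-bounded initial data: `‖(v₀, u₀, θ₀)‖_{H²} ≤ M` and `v₀ ≥ ε`, `θ₀ ≥ ε`. -/
def DataBounded (M ε : ℝ) (v₀ u₀ θ₀ : ℝ → ℝ) : Prop :=
  Real.sqrt (H2sq v₀ + H2sq u₀ + H2sq θ₀) ≤ M ∧ (∀ x, ε ≤ v₀ x) ∧ ∀ x, ε ≤ θ₀ x

variable {μ R a b κ₁ κ₂ β γ T : ℝ}

/-- A solution has `(M, ε)`-bounded initial data. -/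
def Sol.Bounded (S : Sol μ R a b κ₁ κ₂ β γ T) (M ε : ℝ) : Prop :=
  DataBounded M ε (S.v 0) (S.u 0) (S.θ 0)

/-- The auxiliary function `𝔛(t) = ∫₀ᵗ ∫_𝕋 κ(v,θ) θ_t² / v dx ds`. -/
def Sol.X (S : Sol μ R a b κ₁ κ₂ β γ T) (t : ℝ) : ℝ :=
  ∫ s in (0 : ℝ)..t, tInt fun x =>
    kappa κ₁ κ₂ β (S.v s x) (S.θ s x) * (pt S.θ s x) ^ 2 / S.v s x

/-- The auxiliary function `𝔜(t) = max_{0 ≤ s ≤ t} ∫_𝕋 κ(v,θ)² θ_x² / v² dx`. -/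
def Sol.Y (S : Sol μ R a b κ₁ κ₂ β γ T) (t : ℝ) : ℝ :=
  sSup ((fun s => tInt fun x =>
    (kappa κ₁ κ₂ β (S.v s x) (S.θ s x)) ^ 2 * (px S.θ s x) ^ 2 / (S.v s x) ^ 2) ''
      Icc (0 : ℝ) t)

/-- The auxiliary function `ℨ(t) = max_{0 ≤ s ≤ t} ∫_𝕋 u_{xx}² / v² dx`. -/
def Sol.Z (S : Sol μ R a b κ₁ κ₂ β γ T) (t : ℝ) : ℝ :=
  sSup ((fun s => tInt fun x => (px (px S.u) s x) ^ 2 / (S.v s x) ^ 2) '' Icc (0 : ℝ) t)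

/-- The exponent `𝔗₀(n, p, β)`. -/
def T0 (n _p β : ℝ) : ℝ :=
  if n < (β + 3) / 2 then 4 / (n * (2 * β + 3)) else (n - β + 5) / (n * (2 * β + 3))

/-- The exponent `𝔗₁(n, β)`. -/
def T1 (n β : ℝ) : ℝ := max (T0 n 8 β) (1 / (2 * β + 3) + T0 n 1 β)

/-- The exponent `𝔘ʸ₁₁(n, β)`. -/
def Uy11 (n β : ℝ) : ℝ := 2 / (2 * β + 3) + T0 n 1 β

/-- The exponent `𝔘ᶻ₁₁(n, β)`. -/
def Uz11 (n β : ℝ) : ℝ := 3 / 4 * (1 / (1 - T0 n (5/2) β))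

/-- The exponent `𝔘ʸ₂(n, β)`. -/
def Uy2 (n β : ℝ) : ℝ := 2 / (2 * β + 3) + T1 n β

/-- The exponent `𝔘ᶻ₂(n, β)`. -/
def Uz2 (n β : ℝ) : ℝ := 3 / 4 * (1 / (1 - T0 n (3/2) β - T1 n β))

end RadHydro

open RadHydro

namespace RadHydro

/-! ### Integrals over one period -/

lemma tInt_congr {f g : ℝ → ℝ} (h : ∀ x, f x = g x) : tInt f = tInt g := by
  rw [funext h]

lemma tInt_add {f g : ℝ → ℝ} (hf : Continuous f) (hg : Continuous g) :
    tInt (fun x => f x + g x) = tInt f + tInt g :=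
  intervalIntegral.integral_add (hf.intervalIntegrable _ _) (hg.intervalIntegrable _ _)

lemma tInt_sub {f g : ℝ → ℝ} (hf : Continuous f) (hg : Continuous g) :
    tInt (fun x => f x - g x) = tInt f - tInt g :=
  intervalIntegral.integral_sub (hf.intervalIntegrable _ _) (hg.intervalIntegrable _ _)

lemma tInt_const_mul (c : ℝ) (f : ℝ → ℝ) : tInt (fun x => c * f x) = c * tInt f :=
  intervalIntegral.integral_const_mul _ _

lemma tInt_const (c : ℝ) : tInt (fun _ => c) = c := by
  simp only [tInt, intervalIntegral.integral_const, smul_eq_mul]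
  norm_num

lemma tInt_mono {f g : ℝ → ℝ} (hf : Continuous f) (hg : Continuous g)
    (h : ∀ x ∈ Icc (-(1/2) : ℝ) (1/2), f x ≤ g x) : tInt f ≤ tInt g :=
  intervalIntegral.integral_mono_on (by norm_num) (hf.intervalIntegrable _ _)
    (hg.intervalIntegrable _ _) h

lemma tInt_nonneg {f : ℝ → ℝ} (h : ∀ x, 0 ≤ f x) : 0 ≤ tInt f :=
  intervalIntegral.integral_nonneg (by norm_num) fun x _ => h x

lemma tInt_deriv_eq_zero {G G' : ℝ → ℝ} (hG : ∀ x, HasDerivAt G (G' x) x)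
    (hG' : Continuous G') (hper : Function.Periodic G 1) : tInt G' = 0 := by
  have h := intervalIntegral.integral_eq_sub_of_hasDerivAt (a := -(1/2)) (b := 1/2)
    (fun x _ => hG x) (hG'.intervalIntegrable _ _)
  have h2 := hper (-(1/2))
  norm_num at h2
  simp only [tInt, h]
  norm_num
  linarith

/-- A pointwise bound modulo the derivative of a periodic flux integrates to a bound. -/
lemma tInt_le_of_flux {f h G G' : ℝ → ℝ} (hf : Continuous f) (hh : Continuous h)
    (hG : ∀ x, HasDerivAt G (G' x) x) (hG' : Continuous G') (hper : Function.Periodic G 1)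
    (hle : ∀ x ∈ Icc (-(1/2) : ℝ) (1/2), f x ≤ h x + G' x) : tInt f ≤ tInt h := by
  have := tInt_mono (g := fun x => h x + G' x) hf (hh.add hG') hle
  rw [tInt_add hh hG', tInt_deriv_eq_zero hG hG' hper] at this
  linarith

lemma abs_sub_le_tInt {f f' : ℝ → ℝ} (hf : ∀ x, HasDerivAt f (f' x) x) (hf' : Continuous f')
    {x y : ℝ} (hx : x ∈ Icc (-(1/2) : ℝ) (1/2)) (hy : y ∈ Icc (-(1/2) : ℝ) (1/2)) :
    |f x - f y| ≤ tInt fun z => |f' z| := by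
  rw [← intervalIntegral.integral_eq_sub_of_hasDerivAt (a := y) (b := x)
    (fun x _ => hf x) (hf'.intervalIntegrable _ _)]
  refine (intervalIntegral.norm_integral_le_abs_integral_norm (f := f')).trans ?_
  have hsub : uIcc y x ⊆ uIcc (-(1/2)) (1/2 : ℝ) := by
    rw [uIcc_of_le (show (-(1/2) : ℝ) ≤ 1/2 by norm_num)]
    exact uIcc_subset_Icc hy hx
  have h := intervalIntegral.abs_integral_mono_interval (μ := volume)
    (f := fun z => ‖f' z‖) (uIoc_subset_uIoc_of_uIcc_subset_uIcc hsub)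
    (Filter.Eventually.of_forall fun _ => norm_nonneg _)
    (hf'.norm.intervalIntegrable _ _)
  refine h.trans (le_of_eq ?_)
  rw [abs_of_nonneg (intervalIntegral.integral_nonneg (by norm_num) fun _ _ => norm_nonneg _)]
  rfl

lemma le_tInt_add_tInt_abs_deriv {f f' : ℝ → ℝ} (hf : ∀ x, HasDerivAt f (f' x) x)
    (hf' : Continuous f') {x : ℝ} (hx : x ∈ Icc (-(1/2) : ℝ) (1/2)) :
    f x ≤ tInt f + tInt fun z => |f' z| := by
  have hfc : Continuous f := continuous_iff_continuousAt.2 fun x => (hf x).continuousAt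
  have h : tInt (fun _ => f x) ≤ tInt fun y => f y + tInt fun z => |f' z| :=
    tInt_mono continuous_const (by fun_prop) fun y hy => by
      have := (abs_le.1 (abs_sub_le_tInt hf hf' hx hy)).2
      linarith
  rwa [tInt_const, tInt_add hfc continuous_const, tInt_const] at h

lemma exists_le_tInt {f : ℝ → ℝ} (hf : Continuous f) :
    ∃ x ∈ Icc (-(1/2) : ℝ) (1/2), f x ≤ tInt f := by
  obtain ⟨x, hx, hmin⟩ := isCompact_Icc.exists_isMinOn
    (nonempty_Icc.2 (show (-(1/2) : ℝ) ≤ 1/2 by norm_num)) hf.continuousOn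
  refine ⟨x, hx, ?_⟩
  have := tInt_mono continuous_const hf fun y hy => isMinOn_iff.1 hmin y hy
  rwa [tInt_const] at this

/-! ### Integrals depending on time -/

lemma continuous_tInt {F : ℝ → ℝ → ℝ} (hF : Continuous fun p : ℝ × ℝ => F p.1 p.2) :
    Continuous fun t => tInt (F t) :=
  intervalIntegral.continuous_parametric_intervalIntegral_of_continuous' hF _ _

lemma hasDerivAt_integral {F F' : ℝ → ℝ → ℝ} (hF : Continuous fun p : ℝ × ℝ => F p.1 p.2)
    (hF' : Continuous fun p : ℝ × ℝ => F' p.1 p.2)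
    (h : ∀ t x, HasDerivAt (fun s => F s x) (F' t x) t) (c d t : ℝ) :
    HasDerivAt (fun s => ∫ x in c..d, F s x) (∫ x in c..d, F' t x) t := by
  obtain ⟨B, hB⟩ := ((isCompact_Icc (a := t - 1) (b := t + 1)).prod
    (isCompact_uIcc (a := c) (b := d))).exists_bound_of_continuousOn hF'.continuousOn
  have c1 : ∀ s, Continuous (F s) := fun s => by fun_prop
  have c2 : ∀ s, Continuous (F' s) := fun s => by fun_prop
  refine (intervalIntegral.hasDerivAt_integral_of_dominated_loc_of_deriv_le
    (bound := fun _ => B) (Icc_mem_nhds (by linarith) (by linarith : t < t + 1))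
    (Filter.Eventually.of_forall fun s => (c1 s).aestronglyMeasurable)
    ((c1 t).intervalIntegrable _ _) (c2 t).aestronglyMeasurable
    (Filter.Eventually.of_forall fun x hx s hs => hB (s, x) ⟨hs, uIoc_subset_uIcc hx⟩)
    (by simp) (Filter.Eventually.of_forall fun x _ s _ => h s x)).2

lemma hasDerivAt_tInt {F F' : ℝ → ℝ → ℝ} (hF : Continuous fun p : ℝ × ℝ => F p.1 p.2)
    (hF' : Continuous fun p : ℝ × ℝ => F' p.1 p.2)
    (h : ∀ t x, HasDerivAt (fun s => F s x) (F' t x) t) (t : ℝ) :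
    HasDerivAt (fun s => tInt (F s)) (tInt (F' t)) t :=
  hasDerivAt_integral hF hF' h _ _ t

/-- Grönwall's inequality with a dissipation term. -/
lemma gronwall_dissip {y y' D k h : ℝ → ℝ} {T K H : ℝ}
    (hy : ∀ t ∈ Icc 0 T, HasDerivAt y (y' t) t) (hD : Continuous D) (hk : Continuous k)
    (hh : Continuous h) (hD0 : ∀ t, 0 ≤ D t) (hk0 : ∀ t, 0 ≤ k t) (hh0 : ∀ t, 0 ≤ h t)
    (hy0 : 0 ≤ y 0) (hle : ∀ t ∈ Icc 0 T, y' t + D t ≤ k t * y t + h t)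
    (hK : ∀ t ∈ Icc 0 T, ∫ s in (0 : ℝ)..t, k s ≤ K)
    (hH : ∀ t ∈ Icc 0 T, ∫ s in (0 : ℝ)..t, h s ≤ H) :
    ∀ t ∈ Icc 0 T, y t + ∫ s in (0 : ℝ)..t, D s ≤ (y 0 + H) * Real.exp K := by
  intro t ht
  have hI : ∀ {f : ℝ → ℝ}, Continuous f → ∀ s,
      HasDerivAt (fun r => ∫ z in (0 : ℝ)..r, f z) (f s) s := fun hf s =>
    intervalIntegral.integral_hasDerivAt_right (hf.intervalIntegrable _ _)
      hf.aestronglyMeasurable.stronglyMeasurableAtFilter hf.continuousAt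
  have hI0 : ∀ {f : ℝ → ℝ}, (∀ s, 0 ≤ f s) → ∀ s ∈ Icc 0 T, 0 ≤ ∫ z in (0 : ℝ)..s, f z :=
    fun hf s hs => intervalIntegral.integral_nonneg hs.1 fun z _ => hf z
  set A : ℝ → ℝ := fun r => ∫ z in (0 : ℝ)..r, k z with hA
  set P : ℝ → ℝ := fun r => Real.exp (-A r) * (y r + ∫ z in (0 : ℝ)..r, D z)
    - ∫ z in (0 : ℝ)..r, h z with hP
  have hder : ∀ s ∈ Icc 0 T, HasDerivAt P
      (Real.exp (-A s) * (-k s) * (y s + ∫ z in (0 : ℝ)..s, D z)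
        + Real.exp (-A s) * (y' s + D s) - h s) s := fun s hs =>
    (((hI hk s).neg.exp).mul ((hy s hs).add (hI hD s))).sub (hI hh s)
  have hanti : AntitoneOn P (Icc 0 T) := by
    refine antitoneOn_of_hasDerivWithinAt_nonpos (convex_Icc _ _)
      (fun s hs => (hder s hs).continuousAt.continuousWithinAt)
      (fun s hs => (hder s (interior_subset hs)).hasDerivWithinAt) fun s hs => ?_
    have hs' := interior_subset hs
    have e0 := Real.exp_pos (-A s)
    have e1 : Real.exp (-A s) ≤ 1 := by
      rw [Real.exp_le_one_iff]
      have := hI0 hk0 s hs'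
      simp only [hA]; linarith
    have h1 := hle s hs'
    have h2 := mul_nonneg (hk0 s) (hI0 hD0 s hs')
    have h3 : Real.exp (-A s) * (y' s + D s - k s * (y s + ∫ z in (0 : ℝ)..s, D z))
        ≤ Real.exp (-A s) * h s := by
      gcongr; linarith
    nlinarith [mul_le_mul_of_nonneg_right e1 (hh0 s)]
  have h0T : (0 : ℝ) ∈ Icc 0 T := ⟨le_rfl, ht.1.trans ht.2⟩
  have h1 := hanti h0T ht ht.1
  simp only [hP, hA, intervalIntegral.integral_same, neg_zero, Real.exp_zero, one_mul,
    add_zero, sub_zero] at h1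
  have h2 : Real.exp (-∫ z in (0 : ℝ)..t, k z) * (y t + ∫ z in (0 : ℝ)..t, D z) ≤ y 0 + H := by
    linarith [hH t ht]
  have h3 : y t + ∫ z in (0 : ℝ)..t, D z ≤ (y 0 + H) * Real.exp (∫ z in (0 : ℝ)..t, k z) := by
    rw [Real.exp_neg, inv_mul_le_iff₀ (Real.exp_pos _)] at h2
    linarith
  refine h3.trans ?_
  have : 0 ≤ H := (hI0 hh0 t ht).trans (hH t ht)
  gcongr
  exact hK t ht

/-! ### Smooth functions of time and space -/

/-- Joint smoothness in `(t, x)`. -/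
def Smooth₂ (f : ℝ → ℝ → ℝ) : Prop := ContDiff ℝ (⊤ : ℕ∞) fun p : ℝ × ℝ => f p.1 p.2

namespace Smooth₂

variable {f : ℝ → ℝ → ℝ}

lemma hasDerivAt_x_fderiv (hf : Smooth₂ f) (t x : ℝ) :
    HasDerivAt (f t) (fderiv ℝ (fun p : ℝ × ℝ => f p.1 p.2) (t, x) (0, 1)) x := by
  have h := (ContDiff.differentiable hf (by simp) (t, x)).hasFDerivAt
  exact h.comp_hasDerivAt x ((hasDerivAt_const x t).prodMk (hasDerivAt_id x))

lemma hasDerivAt_t_fderiv (hf : Smooth₂ f) (t x : ℝ) :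
    HasDerivAt (fun s => f s x) (fderiv ℝ (fun p : ℝ × ℝ => f p.1 p.2) (t, x) (1, 0)) t := by
  have h := (ContDiff.differentiable hf (by simp) (t, x)).hasFDerivAt
  exact h.comp_hasDerivAt t ((hasDerivAt_id t).prodMk (hasDerivAt_const t x))

lemma px_eq (hf : Smooth₂ f) (t x : ℝ) :
    px f t x = fderiv ℝ (fun p : ℝ × ℝ => f p.1 p.2) (t, x) (0, 1) :=
  (hf.hasDerivAt_x_fderiv t x).deriv

lemma pt_eq (hf : Smooth₂ f) (t x : ℝ) :
    pt f t x = fderiv ℝ (fun p : ℝ × ℝ => f p.1 p.2) (t, x) (1, 0) :=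
  (hf.hasDerivAt_t_fderiv t x).deriv

lemma hasDerivAt_x (hf : Smooth₂ f) (t x : ℝ) : HasDerivAt (f t) (px f t x) x := by
  rw [hf.px_eq]; exact hf.hasDerivAt_x_fderiv t x

lemma hasDerivAt_t (hf : Smooth₂ f) (t x : ℝ) : HasDerivAt (fun s => f s x) (pt f t x) t := by
  rw [hf.pt_eq]; exact hf.hasDerivAt_t_fderiv t x

lemma contDiff_fderiv (hf : Smooth₂ f) :
    ContDiff ℝ (⊤ : ℕ∞) (fderiv ℝ fun p : ℝ × ℝ => f p.1 p.2) :=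
  ContDiff.fderiv_right hf (by norm_cast)

protected lemma px (hf : Smooth₂ f) : Smooth₂ (px f) := by
  have : (fun p : ℝ × ℝ => px f p.1 p.2)
      = fun p => fderiv ℝ (fun p : ℝ × ℝ => f p.1 p.2) p (0, 1) :=
    funext fun p => hf.px_eq p.1 p.2
  rw [Smooth₂, this]
  exact hf.contDiff_fderiv.clm_apply contDiff_const

protected lemma pt (hf : Smooth₂ f) : Smooth₂ (pt f) := by
  have : (fun p : ℝ × ℝ => pt f p.1 p.2)
      = fun p => fderiv ℝ (fun p : ℝ × ℝ => f p.1 p.2) p (1, 0) :=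
    funext fun p => hf.pt_eq p.1 p.2
  rw [Smooth₂, this]
  exact hf.contDiff_fderiv.clm_apply contDiff_const

lemma pt_px (hf : Smooth₂ f) (t x : ℝ) : pt (px f) t x = px (pt f) t x := by
  have hd : DifferentiableAt ℝ (fderiv ℝ fun p : ℝ × ℝ => f p.1 p.2) (t, x) :=
    hf.contDiff_fderiv.differentiable (by simp) _
  have key : ∀ w : ℝ × ℝ, fderiv ℝ (fun p => fderiv ℝ (fun p : ℝ × ℝ => f p.1 p.2) p w) (t, x)
      = (fderiv ℝ (fderiv ℝ fun p : ℝ × ℝ => f p.1 p.2) (t, x)).flip w := fun w => by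
    rw [fderiv_clm_apply hd (differentiableAt_const _)]
    simp
  have hs : IsSymmSndFDerivAt ℝ (fun p : ℝ × ℝ => f p.1 p.2) (t, x) :=
    (ContDiff.contDiffAt hf).isSymmSndFDerivAt (by simp; norm_cast)
  rw [hf.px.pt_eq, hf.pt.px_eq, funext fun p : ℝ × ℝ => hf.px_eq p.1 p.2,
    funext fun p : ℝ × ℝ => hf.pt_eq p.1 p.2]
  simp only [Prod.mk.eta, key, ContinuousLinearMap.flip_apply]
  exact hs _ _

lemma continuous_comp (hf : Smooth₂ f) {X : Type*} [TopologicalSpace X] {g h : X → ℝ}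
    (hg : Continuous g) (hh : Continuous h) : Continuous fun z => f (g z) (h z) :=
  (ContDiff.continuous hf).comp (hg.prodMk hh)

end Smooth₂

lemma periodic_px {f : ℝ → ℝ → ℝ} (h : ∀ t, Function.Periodic (f t) 1) (t : ℝ) :
    Function.Periodic (px f t) 1 := fun x => by
  rw [px, px, ← deriv_comp_add_const]
  congr 1
  exact funext (h t)

lemma periodic_pt {f : ℝ → ℝ → ℝ} (h : ∀ t, Function.Periodic (f t) 1) (t : ℝ) :
    Function.Periodic (pt f t) 1 := fun x => by
  simp only [pt]
  congr 1
  exact funext fun s => h s x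

namespace Sol

variable {μ R a b κ₁ κ₂ β γ T : ℝ} (S : Sol μ R a b κ₁ κ₂ β γ T)

/-! ### Derivatives of a solution -/

/-- `v_x` -/
def vx : ℝ → ℝ → ℝ := px S.v
/-- `u_x` -/
def ux : ℝ → ℝ → ℝ := px S.u
/-- `u_{xx}` -/
def uxx : ℝ → ℝ → ℝ := px S.ux
/-- `θ_x` -/
def θx : ℝ → ℝ → ℝ := px S.θ
/-- `q_x` -/
def qx : ℝ → ℝ → ℝ := px S.q
/-- `v_t` -/
def vt : ℝ → ℝ → ℝ := pt S.v
/-- `u_t` -/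
def ut : ℝ → ℝ → ℝ := pt S.u
/-- `θ_t` -/
def θt : ℝ → ℝ → ℝ := pt S.θ
/-- `v_{tx}` -/
def vtx : ℝ → ℝ → ℝ := px S.vt
/-- `u_{tx}` -/
def utx : ℝ → ℝ → ℝ := px S.ut
/-- The heat flux `κ(v, θ) θ_x / v`. -/
def heat (t x : ℝ) : ℝ := kappa κ₁ κ₂ β (S.v t x) (S.θ t x) * S.θx t x / S.v t x
/-- `(κ(v, θ) θ_x / v)_x` -/
def heatx : ℝ → ℝ → ℝ := px S.heat
/-- The radiative potential `b θ⁴ - q_x / v`. -/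
def pot (t x : ℝ) : ℝ := b * S.θ t x ^ 4 - S.qx t x / S.v t x

@[simp] lemma v_ne (t x : ℝ) : S.v t x ≠ 0 := (S.v_pos t x).ne'
@[simp] lemma θ_ne (t x : ℝ) : S.θ t x ≠ 0 := (S.θ_pos t x).ne'

lemma smooth₂_v : Smooth₂ S.v := S.smooth_v
lemma smooth₂_u : Smooth₂ S.u := S.smooth_u
lemma smooth₂_θ : Smooth₂ S.θ := S.smooth_θ
lemma smooth₂_q : Smooth₂ S.q := S.smooth_q
lemma smooth₂_vx : Smooth₂ S.vx := S.smooth₂_v.px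
lemma smooth₂_ux : Smooth₂ S.ux := S.smooth₂_u.px
lemma smooth₂_uxx : Smooth₂ S.uxx := S.smooth₂_ux.px
lemma smooth₂_θx : Smooth₂ S.θx := S.smooth₂_θ.px
lemma smooth₂_qx : Smooth₂ S.qx := S.smooth₂_q.px
lemma smooth₂_vt : Smooth₂ S.vt := S.smooth₂_v.pt
lemma smooth₂_ut : Smooth₂ S.ut := S.smooth₂_u.pt
lemma smooth₂_θt : Smooth₂ S.θt := S.smooth₂_θ.pt
lemma smooth₂_vtx : Smooth₂ S.vtx := S.smooth₂_vt.px
lemma smooth₂_utx : Smooth₂ S.utx := S.smooth₂_ut.px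

lemma smooth₂_heat : Smooth₂ S.heat := by
  have hv := S.smooth_v
  have hθ := S.smooth_θ
  have hθx : ContDiff ℝ (⊤ : ℕ∞) fun p : ℝ × ℝ => S.θx p.1 p.2 := S.smooth₂_θx
  have hr : ContDiff ℝ (⊤ : ℕ∞) fun p : ℝ × ℝ => S.θ p.1 p.2 ^ β :=
    hθ.rpow_const_of_ne fun p => S.θ_ne _ _
  exact ((contDiff_const.add ((contDiff_const.mul hv).mul hr)).mul hθx).div hv
    fun p => S.v_ne _ _

lemma smooth₂_heatx : Smooth₂ S.heatx := S.smooth₂_heat.px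

section continuity

variable {X : Type*} [TopologicalSpace X] {f g : X → ℝ}

@[fun_prop] lemma continuous_v (hf : Continuous f) (hg : Continuous g) :
    Continuous fun z => S.v (f z) (g z) := S.smooth₂_v.continuous_comp hf hg
@[fun_prop] lemma continuous_u (hf : Continuous f) (hg : Continuous g) :
    Continuous fun z => S.u (f z) (g z) := S.smooth₂_u.continuous_comp hf hg
@[fun_prop] lemma continuous_θ (hf : Continuous f) (hg : Continuous g) :
    Continuous fun z => S.θ (f z) (g z) := S.smooth₂_θ.continuous_comp hf hg
@[fun_prop] lemma continuous_q (hf : Continuous f) (hg : Continuous g) :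
    Continuous fun z => S.q (f z) (g z) := S.smooth₂_q.continuous_comp hf hg
@[fun_prop] lemma continuous_vx (hf : Continuous f) (hg : Continuous g) :
    Continuous fun z => S.vx (f z) (g z) := S.smooth₂_vx.continuous_comp hf hg
@[fun_prop] lemma continuous_ux (hf : Continuous f) (hg : Continuous g) :
    Continuous fun z => S.ux (f z) (g z) := S.smooth₂_ux.continuous_comp hf hg
@[fun_prop] lemma continuous_uxx (hf : Continuous f) (hg : Continuous g) :
    Continuous fun z => S.uxx (f z) (g z) := S.smooth₂_uxx.continuous_comp hf hg
@[fun_prop] lemma continuous_θx (hf : Continuous f) (hg : Continuous g) :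
    Continuous fun z => S.θx (f z) (g z) := S.smooth₂_θx.continuous_comp hf hg
@[fun_prop] lemma continuous_qx (hf : Continuous f) (hg : Continuous g) :
    Continuous fun z => S.qx (f z) (g z) := S.smooth₂_qx.continuous_comp hf hg
@[fun_prop] lemma continuous_vt (hf : Continuous f) (hg : Continuous g) :
    Continuous fun z => S.vt (f z) (g z) := S.smooth₂_vt.continuous_comp hf hg
@[fun_prop] lemma continuous_ut (hf : Continuous f) (hg : Continuous g) :
    Continuous fun z => S.ut (f z) (g z) := S.smooth₂_ut.continuous_comp hf hg
@[fun_prop] lemma continuous_θt (hf : Continuous f) (hg : Continuous g) :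
    Continuous fun z => S.θt (f z) (g z) := S.smooth₂_θt.continuous_comp hf hg
@[fun_prop] lemma continuous_vtx (hf : Continuous f) (hg : Continuous g) :
    Continuous fun z => S.vtx (f z) (g z) := S.smooth₂_vtx.continuous_comp hf hg
@[fun_prop] lemma continuous_utx (hf : Continuous f) (hg : Continuous g) :
    Continuous fun z => S.utx (f z) (g z) := S.smooth₂_utx.continuous_comp hf hg
@[fun_prop] lemma continuous_heat (hf : Continuous f) (hg : Continuous g) :
    Continuous fun z => S.heat (f z) (g z) := S.smooth₂_heat.continuous_comp hf hg
@[fun_prop] lemma continuous_heatx (hf : Continuous f) (hg : Continuous g) :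
    Continuous fun z => S.heatx (f z) (g z) := S.smooth₂_heatx.continuous_comp hf hg
@[fun_prop] lemma continuous_pot (hf : Continuous f) (hg : Continuous g) :
    Continuous fun z => S.pot (f z) (g z) := by
  unfold pot
  fun_prop (disch := simp)

end continuity

section derivatives

variable (t x : ℝ)

lemma hasDerivAt_v_x : HasDerivAt (S.v t) (S.vx t x) x := S.smooth₂_v.hasDerivAt_x t x
lemma hasDerivAt_u_x : HasDerivAt (S.u t) (S.ux t x) x := S.smooth₂_u.hasDerivAt_x t x
lemma hasDerivAt_θ_x : HasDerivAt (S.θ t) (S.θx t x) x := S.smooth₂_θ.hasDerivAt_x t x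
lemma hasDerivAt_q_x : HasDerivAt (S.q t) (S.qx t x) x := S.smooth₂_q.hasDerivAt_x t x
lemma hasDerivAt_ux_x : HasDerivAt (S.ux t) (S.uxx t x) x := S.smooth₂_ux.hasDerivAt_x t x
lemma hasDerivAt_ut_x : HasDerivAt (S.ut t) (S.utx t x) x := S.smooth₂_ut.hasDerivAt_x t x
lemma hasDerivAt_heat_x : HasDerivAt (S.heat t) (S.heatx t x) x :=
  S.smooth₂_heat.hasDerivAt_x t x
lemma hasDerivAt_v_t : HasDerivAt (fun s => S.v s x) (S.vt t x) t :=
  S.smooth₂_v.hasDerivAt_t t x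
lemma hasDerivAt_u_t : HasDerivAt (fun s => S.u s x) (S.ut t x) t :=
  S.smooth₂_u.hasDerivAt_t t x
lemma hasDerivAt_θ_t : HasDerivAt (fun s => S.θ s x) (S.θt t x) t :=
  S.smooth₂_θ.hasDerivAt_t t x
lemma hasDerivAt_vx_t : HasDerivAt (fun s => S.vx s x) (S.vtx t x) t := by
  have h := S.smooth₂_vx.hasDerivAt_t t x
  rwa [vx, S.smooth₂_v.pt_px] at h
lemma hasDerivAt_ux_t : HasDerivAt (fun s => S.ux s x) (S.utx t x) t := by
  have h := S.smooth₂_ux.hasDerivAt_t t x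
  rwa [ux, S.smooth₂_u.pt_px] at h

lemma hasDerivAt_θ_rpow_x (r : ℝ) :
    HasDerivAt (fun y => S.θ t y ^ r) (S.θx t x * r * S.θ t x ^ (r - 1)) x :=
  (S.hasDerivAt_θ_x t x).rpow_const (Or.inl (S.θ_ne t x))

lemma hasDerivAt_θ_rpow_t (r : ℝ) :
    HasDerivAt (fun s => S.θ s x ^ r) (S.θt t x * r * S.θ t x ^ (r - 1)) t :=
  (S.hasDerivAt_θ_t t x).rpow_const (Or.inl (S.θ_ne t x))

end derivatives

lemma periodic_ux (t : ℝ) : Function.Periodic (S.ux t) 1 := periodic_px S.periodic_u t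
lemma periodic_θx (t : ℝ) : Function.Periodic (S.θx t) 1 := periodic_px S.periodic_θ t
lemma periodic_qx (t : ℝ) : Function.Periodic (S.qx t) 1 := periodic_px S.periodic_q t
lemma periodic_ut (t : ℝ) : Function.Periodic (S.ut t) 1 := periodic_pt S.periodic_u t
lemma periodic_heat (t : ℝ) : Function.Periodic (S.heat t) 1 := fun x => by
  simp only [heat, S.periodic_v t x, S.periodic_θ t x, S.periodic_θx t x]
lemma periodic_pot (t : ℝ) : Function.Periodic (S.pot t) 1 := fun x => by
  simp only [pot, S.periodic_v t x, S.periodic_θ t x, S.periodic_qx t x]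

/-! ### The equations in expanded form -/

variable {t : ℝ}

lemma vt_eq (ht : t ∈ Icc 0 T) (x : ℝ) : S.vt t x = S.ux t x :=
  sub_eq_zero.1 (S.eq_mass t ht x)

lemma vtx_eq (ht : t ∈ Icc 0 T) (x : ℝ) : S.vtx t x = S.uxx t x := by
  have : S.vt t = S.ux t := funext (S.vt_eq ht)
  rw [vtx, uxx, px, px, this]

lemma ut_eq_deriv (ht : t ∈ Icc 0 T) (x : ℝ) :
    HasDerivAt (fun y => μ * S.ux t y / S.v t y - R * S.θ t y / S.v t y) (S.ut t x) x := by
  have h1 := ((S.hasDerivAt_ux_x t x).const_mul μ).div (S.hasDerivAt_v_x t x) (S.v_ne t x)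
  have h2 := ((S.hasDerivAt_θ_x t x).const_mul R).div (S.hasDerivAt_v_x t x) (S.v_ne t x)
  have h : S.ut t x + deriv (fun y => R * S.θ t y / S.v t y) x
      = deriv (fun y => μ * S.ux t y / S.v t y) x := S.eq_mom t ht x
  rw [eq_sub_of_add_eq h]
  exact h1.differentiableAt.hasDerivAt.sub h2.differentiableAt.hasDerivAt

lemma ut_eq (ht : t ∈ Icc 0 T) (x : ℝ) :
    S.ut t x = μ * (S.uxx t x / S.v t x - S.ux t x * S.vx t x / S.v t x ^ 2)
      - R * (S.θx t x / S.v t x - S.θ t x * S.vx t x / S.v t x ^ 2) := by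
  have h1 := ((S.hasDerivAt_ux_x t x).const_mul μ).div (S.hasDerivAt_v_x t x) (S.v_ne t x)
  have h2 := ((S.hasDerivAt_θ_x t x).const_mul R).div (S.hasDerivAt_v_x t x) (S.v_ne t x)
  rw [(S.ut_eq_deriv ht x).unique (h1.sub h2)]
  have := S.v_ne t x
  field_simp

lemma energy_density_eq (ht : t ∈ Icc 0 T) (x : ℝ) :
    R / (γ - 1) * S.θt t x + S.u t x * S.ut t x
      + deriv (fun y => R * S.θ t y / S.v t y * S.u t y) x + S.qx t x
      = deriv (fun y => μ * S.u t y * S.ux t y / S.v t y) x + S.heatx t x := by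
  have h := S.eq_energy t ht x
  have h1 := ((S.hasDerivAt_θ_t t x).const_mul (R / (γ - 1))).add
    (((S.hasDerivAt_u_t t x).pow 2).div_const 2)
  have h2 : pt (fun s y => R / (γ - 1) * S.θ s y + S.u s y ^ 2 / 2) t x = _ := h1.deriv
  rw [h2] at h
  have e : R / (γ - 1) * S.θt t x + S.u t x * S.ut t x
      = R / (γ - 1) * S.θt t x + (↑(2 : ℕ) * S.u t x ^ (2 - 1) * S.ut t x) / 2 := by
    norm_num
    ring
  rw [e]
  exact h

lemma θt_eq (ht : t ∈ Icc 0 T) (x : ℝ) :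
    R / (γ - 1) * S.θt t x = μ * S.ux t x ^ 2 / S.v t x + S.heatx t x
      - R * S.θ t x * S.ux t x / S.v t x - S.qx t x := by
  have h := S.energy_density_eq ht x
  have hv := S.hasDerivAt_v_x t x
  have hu := S.hasDerivAt_u_x t x
  have h1 := (((S.hasDerivAt_θ_x t x).const_mul R).div hv (S.v_ne t x)).mul hu
  have h2 := ((hu.const_mul μ).mul (S.hasDerivAt_ux_x t x)).div hv (S.v_ne t x)
  have d1 : deriv (fun y => R * S.θ t y / S.v t y * S.u t y) x = _ := h1.deriv
  have d2 : deriv (fun y => μ * S.u t y * S.ux t y / S.v t y) x = _ := h2.deriv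
  rw [d1, d2, S.ut_eq ht] at h
  simp only [Pi.mul_apply, Pi.div_apply] at h
  have := S.v_ne t x
  rw [← sub_eq_zero] at h ⊢
  rw [← h]
  field_simp
  ring

lemma hasDerivAt_pot_x (ht : t ∈ Icc 0 T) (x : ℝ) :
    HasDerivAt (S.pot t) (-(a * S.v t x * S.q t x)) x := by
  have h : -deriv (fun y => S.qx t y / S.v t y) x + a * S.v t x * S.q t x
    + b * deriv (fun y => S.θ t y ^ 4) x = 0 := S.eq_rad t ht x
  have h1 := ((S.smooth₂_qx.hasDerivAt_x t x).div (S.hasDerivAt_v_x t x)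
    (S.v_ne t x)).differentiableAt.hasDerivAt
  have h2 := ((S.hasDerivAt_θ_x t x).pow 4).differentiableAt.hasDerivAt
  refine ((h2.const_mul b).sub h1).congr_deriv ?_
  change b * deriv (fun y => S.θ t y ^ 4) x - deriv (fun y => S.qx t y / S.v t y) x = _
  linarith

end Sol

/-- Positivity of the physical constants and normalization of the data bounds. -/
structure Admissible (μ R a b κ₁ κ₂ β γ T M ε : ℝ) : Prop where
  μ_pos : 0 < μ
  R_pos : 0 < R
  a_pos : 0 < a
  b_pos : 0 < b
  κ₁_pos : 0 < κ₁
  κ₂_pos : 0 < κ₂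
  β_pos : 0 < β
  one_lt_γ : 1 < γ
  T_pos : 0 < T
  one_le_M : 1 ≤ M
  ε_pos : 0 < ε

namespace Sol

variable {μ R a b κ₁ κ₂ β γ T M ε : ℝ}

/-! ### The radiative term is dissipative -/

lemma qx_eq (S : Sol μ R a b κ₁ κ₂ β γ T) (t x : ℝ) :
    S.qx t x = S.v t x * (b * S.θ t x ^ 4 - S.pot t x) := by
  have := S.v_ne t x
  rw [pot]
  field_simp
  ring

lemma pot_pos (A : Admissible μ R a b κ₁ κ₂ β γ T M ε) (S : Sol μ R a b κ₁ κ₂ β γ T) {t : ℝ}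
    (ht : t ∈ Icc 0 T) (x : ℝ) : 0 < S.pot t x := by
  have hc : Continuous (S.pot t) := by fun_prop
  obtain ⟨_, ⟨z, rfl⟩, hmin⟩ := (Function.Periodic.compact_of_continuous (S.periodic_pot t)
    one_ne_zero hc).exists_isLeast (range_nonempty _)
  have hz : ∀ y, S.pot t z ≤ S.pot t y := fun y => hmin ⟨y, rfl⟩
  refine lt_of_lt_of_le ?_ (hz x)
  by_contra! hneg
  have hq : S.q t z = 0 := by
    have h0 := IsLocalMin.hasDerivAt_eq_zero (f := S.pot t) (Filter.Eventually.of_forall hz)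
      (S.hasDerivAt_pot_x ht z)
    have h1 := A.a_pos.ne'
    simpa [h1] using h0
  have hqx : 0 < S.qx t z := by
    rw [qx_eq]
    have h1 := mul_pos A.b_pos (pow_pos (S.θ_pos t z) 4)
    exact mul_pos (S.v_pos t z) (by linarith)
  have hd : deriv (fun y => -S.pot t y) = fun y => a * S.v t y * S.q t y :=
    funext fun y => by simpa using (S.hasDerivAt_pot_x ht y).neg.deriv
  have hdd : deriv (deriv fun y => -S.pot t y) z = a * S.v t z * S.qx t z := by
    rw [hd]
    have h := (((S.hasDerivAt_v_x t z).const_mul a).mul (S.hasDerivAt_q_x t z)).deriv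
    refine h.trans ?_
    rw [hq]
    ring
  have hloc : IsLocalMin (fun y => -S.pot t y) z :=
    isLocalMin_of_deriv_deriv_pos
      (by rw [hdd]; exact mul_pos (mul_pos A.a_pos (S.v_pos t z)) hqx)
      (by rw [hd]; simp [hq]) hc.neg.continuousAt
  have hconst : ∀ᶠ y in nhds z, S.pot t y = S.pot t z := by
    filter_upwards [hloc] with y hy
    exact le_antisymm (by linarith) (hz y)
  have hq0 : ∀ᶠ y in nhds z, S.q t y = 0 := by
    filter_upwards [hconst.eventually_nhds] with y hy
    have h1 := (S.hasDerivAt_pot_x ht y).unique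
      ((hasDerivAt_const y (S.pot t z)).congr_of_eventuallyEq hy)
    have h2 := A.a_pos.ne'
    simpa [h2] using h1
  have : S.qx t z = 0 :=
    (S.hasDerivAt_q_x t z).unique ((hasDerivAt_const z (0 : ℝ)).congr_of_eventuallyEq hq0)
  exact hqx.ne' this

lemma rpow_monotone_mul {A B s : ℝ} (hA : 0 < A) (hB : 0 < B) :
    0 ≤ s * ((A - B) * (A ^ s - B ^ s)) := by
  rcases le_total A B with h | h <;> rcases le_total 0 s with hs | hs
  · have := rpow_le_rpow hA.le h hs
    exact mul_nonneg hs (mul_nonneg_of_nonpos_of_nonpos (by linarith) (by linarith))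
  · have := rpow_le_rpow_of_nonpos hA h hs
    exact mul_nonneg_of_nonpos_of_nonpos hs
      (mul_nonpos_of_nonpos_of_nonneg (by linarith) (by linarith))
  · have := rpow_le_rpow hB.le h hs
    exact mul_nonneg hs (mul_nonneg (by linarith) (by linarith))
  · have := rpow_le_rpow_of_nonpos hB h hs
    exact mul_nonneg_of_nonpos_of_nonpos hs
      (mul_nonpos_of_nonneg_of_nonpos (by linarith) (by linarith))

lemma radiation_dissipative (A : Admissible μ R a b κ₁ κ₂ β γ T M ε)
    (S : Sol μ R a b κ₁ κ₂ β γ T) {t : ℝ} (ht : t ∈ Icc 0 T) (r : ℝ) :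
    0 ≤ tInt fun x => r * (S.qx t x * S.θ t x ^ r) := by
  have hb := A.b_pos
  have hψ : ∀ x, 0 < S.pot t x / b := fun x => div_pos (S.pot_pos A ht x) hb
  set G : ℝ → ℝ := fun x => -(4 * (r / 4) * (S.q t x * (S.pot t x / b) ^ (r / 4))) with hG
  set G' : ℝ → ℝ := fun x => -(4 * (r / 4) * (S.qx t x * (S.pot t x / b) ^ (r / 4)
    + S.q t x * (-(a * S.v t x * S.q t x) / b * (r / 4) * (S.pot t x / b) ^ (r / 4 - 1))))
    with hG'
  have hcr : ∀ s : ℝ, Continuous fun x => (S.pot t x / b) ^ s := fun s =>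
    Continuous.rpow_const (by fun_prop) fun x => Or.inl (hψ x).ne'
  have hcθ : Continuous fun x => S.θ t x ^ r :=
    Continuous.rpow_const (by fun_prop) fun x => Or.inl (S.θ_ne t x)
  have key := tInt_le_of_flux (f := fun _ => 0) (h := fun x => r * (S.qx t x * S.θ t x ^ r))
    (G := G) (G' := G') continuous_const (by fun_prop)
    (fun x => (((S.hasDerivAt_q_x t x).mul (((S.hasDerivAt_pot_x ht x).div_const b).rpow_const
      (Or.inl (hψ x).ne'))).const_mul _).neg)
    (by have h1 := hcr (r / 4); have h2 := hcr (r / 4 - 1); fun_prop)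
    (fun x => by simp only [hG, S.periodic_q t x, S.periodic_pot t x])
    fun x _ => by
      have h1 : S.θ t x ^ r = (S.θ t x ^ 4) ^ (r / 4) := by
        rw [← rpow_natCast, ← rpow_mul (S.θ_pos t x).le]
        congr 1
        push_cast
        ring
      have h2 := rpow_monotone_mul (s := r / 4) (pow_pos (S.θ_pos t x) 4) (hψ x)
      have h3 : S.qx t x = b * S.v t x * (S.θ t x ^ 4 - S.pot t x / b) := by
        rw [qx_eq]; field_simp
      have h4 : 0 ≤ b * S.v t x := mul_nonneg hb.le (S.v_pos t x).le
      have h5 : 0 ≤ 4 * (r / 4) ^ 2 * (a * S.v t x * S.q t x ^ 2 / b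
          * (S.pot t x / b) ^ (r / 4 - 1)) := by
        have := A.a_pos
        have := S.v_pos t x
        have := hψ x
        positivity
      have h6 : r * (S.qx t x * S.θ t x ^ r) + G' x
          = 4 * (b * S.v t x * (r / 4 * ((S.θ t x ^ 4 - S.pot t x / b)
            * ((S.θ t x ^ 4) ^ (r / 4) - (S.pot t x / b) ^ (r / 4)))))
          + 4 * (r / 4) ^ 2 * (a * S.v t x * S.q t x ^ 2 / b
          * (S.pot t x / b) ^ (r / 4 - 1)) := by
        simp only [hG']
        rw [h1, h3]
        ring
      rw [h6]
      have := mul_nonneg h4 h2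
      linarith
  rwa [tInt_const] at key

/-! ### Balance laws -/

lemma tInt_v_eq_one (S : Sol μ R a b κ₁ κ₂ β γ T) {t : ℝ} (ht : t ∈ Icc 0 T) :
    tInt (S.v t) = 1 := by
  have hder : ∀ s ∈ Icc 0 T, HasDerivAt (fun s => tInt (S.v s)) 0 s := fun s hs => by
    have h := hasDerivAt_tInt (F := S.v) (F' := S.vt) (by fun_prop) (by fun_prop)
      (fun t x => S.hasDerivAt_v_t t x) s
    rwa [tInt_congr (S.vt_eq hs), tInt_deriv_eq_zero (S.hasDerivAt_u_x s) (by fun_prop)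
      (S.periodic_u s)] at h
  rw [← S.mean_v]
  exact constant_of_has_deriv_right_zero
    (fun s hs => (hder s hs).continuousAt.continuousWithinAt)
    (fun s hs => (hder s (Ico_subset_Icc_self hs)).hasDerivWithinAt) t ht

lemma energy_conserved (S : Sol μ R a b κ₁ κ₂ β γ T) {t : ℝ} (ht : t ∈ Icc 0 T) :
    tInt (fun x => R / (γ - 1) * S.θ t x + S.u t x ^ 2 / 2)
      = tInt fun x => R / (γ - 1) * S.θ 0 x + S.u 0 x ^ 2 / 2 := by
  have hder : ∀ s ∈ Icc 0 T, HasDerivAt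
      (fun s => tInt fun x => R / (γ - 1) * S.θ s x + S.u s x ^ 2 / 2) 0 s := fun s hs => by
    have h := hasDerivAt_tInt (F := fun s x => R / (γ - 1) * S.θ s x + S.u s x ^ 2 / 2)
      (F' := fun s x => R / (γ - 1) * S.θt s x + 2 * S.u s x * S.ut s x / 2)
      (by fun_prop) (by fun_prop)
      (fun t x => (((S.hasDerivAt_θ_t t x).const_mul (R / (γ - 1))).add
        (((S.hasDerivAt_u_t t x).pow 2).div_const 2)).congr_deriv (by norm_num)) s
    rwa [tInt_deriv_eq_zero (G := fun x => S.u s x * (μ * S.ux s x / S.v s x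
      - R * S.θ s x / S.v s x) + S.heat s x - S.q s x) (fun x => by
        have h1 := (((S.hasDerivAt_u_x s x).mul (S.ut_eq_deriv hs x)).add
          (S.hasDerivAt_heat_x s x)).sub (S.hasDerivAt_q_x s x)
        refine h1.congr_deriv ?_
        rw [S.θt_eq hs]
        ring) (by fun_prop) (fun x => by
          simp only [S.periodic_u s x, S.periodic_ux s x, S.periodic_v s x, S.periodic_θ s x,
            S.periodic_heat s x, S.periodic_q s x])] at h
  exact constant_of_has_deriv_right_zero
    (fun s hs => (hder s hs).continuousAt.continuousWithinAt)
    (fun s hs => (hder s (Ico_subset_Icc_self hs)).hasDerivWithinAt) t ht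

@[fun_prop] lemma continuous_θ_rpow (S : Sol μ R a b κ₁ κ₂ β γ T) {X : Type*}
    [TopologicalSpace X] {f g : X → ℝ} (hf : Continuous f) (hg : Continuous g) (r : ℝ) :
    Continuous fun z => S.θ (f z) (g z) ^ r :=
  Continuous.rpow_const (by fun_prop) fun _ => Or.inl (S.θ_ne _ _)

lemma heat_eq (S : Sol μ R a b κ₁ κ₂ β γ T) (t x : ℝ) :
    S.heat t x = (κ₁ / S.v t x + κ₂ * S.θ t x ^ β) * S.θx t x := by
  have := S.v_ne t x
  rw [heat, kappa]
  field_simp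

/-- Testing the temperature equation with `θ ^ r`. -/
lemma power_balance (A : Admissible μ R a b κ₁ κ₂ β γ T M ε) (S : Sol μ R a b κ₁ κ₂ β γ T)
    {t : ℝ} (ht : t ∈ Icc 0 T) (r : ℝ) :
    tInt (fun x => r * (R / (γ - 1) * S.θt t x * S.θ t x ^ r)) ≤
      tInt fun x => r * (μ * S.ux t x ^ 2 / S.v t x - R * S.θ t x * S.ux t x / S.v t x)
        * S.θ t x ^ r
        - r ^ 2 * ((κ₁ / S.v t x + κ₂ * S.θ t x ^ β) * S.θx t x ^ 2 * S.θ t x ^ (r - 1)) := by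
  have h := tInt_le_of_flux
    (f := fun x => r * (R / (γ - 1) * S.θt t x * S.θ t x ^ r)
      + r * (S.qx t x * S.θ t x ^ r))
    (h := fun x => r * (μ * S.ux t x ^ 2 / S.v t x - R * S.θ t x * S.ux t x / S.v t x)
        * S.θ t x ^ r
        - r ^ 2 * ((κ₁ / S.v t x + κ₂ * S.θ t x ^ β) * S.θx t x ^ 2 * S.θ t x ^ (r - 1)))
    (G := fun x => r * (S.heat t x * S.θ t x ^ r))
    (by fun_prop) (by fun_prop (disch := simp))
    (fun x => ((S.hasDerivAt_heat_x t x).mul (S.hasDerivAt_θ_rpow_x t x r)).const_mul r)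
    (by fun_prop)
    (fun x => by simp only [S.periodic_heat t x, S.periodic_θ t x])
    (fun x _ => by
      rw [S.θt_eq ht, S.heat_eq]
      exact le_of_eq (by ring))
  rw [tInt_add (by fun_prop) (by fun_prop)] at h
  have := S.radiation_dissipative A ht r
  linarith

/-! ### Bounds on the initial data and the energy bound -/

lemma initial_bounds (A : Admissible μ R a b κ₁ κ₂ β γ T M ε)
    {S : Sol μ R a b κ₁ κ₂ β γ T} (hS : S.Bounded M ε) :
    tInt (fun x => S.u 0 x ^ 2) ≤ M ^ 2 ∧ tInt (fun x => S.ux 0 x ^ 2) ≤ M ^ 2 ∧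
    tInt (fun x => S.vx 0 x ^ 2) ≤ M ^ 2 ∧ tInt (fun x => S.θ 0 x ^ 2) ≤ M ^ 2 ∧
    tInt (fun x => S.θx 0 x ^ 2) ≤ M ^ 2 := by
  have h := hS.1
  have hn : ∀ f, 0 ≤ L2sq f := fun f => tInt_nonneg fun x => sq_nonneg _
  rw [Real.sqrt_le_left (by linarith [A.one_le_M])] at h
  simp only [H2sq] at h
  have n1 := hn (S.v 0)
  have n2 := hn (deriv (S.v 0))
  have n3 := hn (deriv (deriv (S.v 0)))
  have n4 := hn (S.u 0)
  have n5 := hn (deriv (S.u 0))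
  have n6 := hn (deriv (deriv (S.u 0)))
  have n7 := hn (S.θ 0)
  have n8 := hn (deriv (S.θ 0))
  have n9 := hn (deriv (deriv (S.θ 0)))
  refine ⟨?_, ?_, ?_, ?_, ?_⟩
  · change L2sq (S.u 0) ≤ _; linarith
  · change L2sq (deriv (S.u 0)) ≤ _; linarith
  · change L2sq (deriv (S.v 0)) ≤ _; linarith
  · change L2sq (S.θ 0) ≤ _; linarith
  · change L2sq (deriv (S.θ 0)) ≤ _; linarith

lemma initial_θ_le (A : Admissible μ R a b κ₁ κ₂ β γ T M ε)
    {S : Sol μ R a b κ₁ κ₂ β γ T} (hS : S.Bounded M ε) {x : ℝ}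
    (hx : x ∈ Icc (-(1/2) : ℝ) (1/2)) : S.θ 0 x ≤ 2 + 2 * M ^ 2 := by
  obtain ⟨-, -, -, h1, h2⟩ := S.initial_bounds A hS
  have h3 := le_tInt_add_tInt_abs_deriv (S.hasDerivAt_θ_x 0) (by fun_prop) hx
  have h4 : tInt (S.θ 0) ≤ tInt fun x => 1 + S.θ 0 x ^ 2 :=
    tInt_mono (by fun_prop) (by fun_prop) fun y _ => by nlinarith [sq_nonneg (S.θ 0 y - 1)]
  have h5 : (tInt fun x => |S.θx 0 x|) ≤ tInt fun x => 1 + S.θx 0 x ^ 2 :=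
    tInt_mono (by fun_prop) (by fun_prop) fun y _ => by
      rw [← sq_abs (S.θx 0 y)]; nlinarith [sq_nonneg (|S.θx 0 y| - 1)]
  rw [tInt_add (by fun_prop) (by fun_prop), tInt_const] at h4 h5
  linarith

lemma initial_v_le (A : Admissible μ R a b κ₁ κ₂ β γ T M ε)
    {S : Sol μ R a b κ₁ κ₂ β γ T} (hS : S.Bounded M ε) {x : ℝ}
    (hx : x ∈ Icc (-(1/2) : ℝ) (1/2)) : S.v 0 x ≤ 2 + M ^ 2 := by
  obtain ⟨-, -, h2, -⟩ := S.initial_bounds A hS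
  have h3 := le_tInt_add_tInt_abs_deriv (S.hasDerivAt_v_x 0) (by fun_prop) hx
  have h5 : (tInt fun x => |S.vx 0 x|) ≤ tInt fun x => 1 + S.vx 0 x ^ 2 :=
    tInt_mono (by fun_prop) (by fun_prop) fun y _ => by
      rw [← sq_abs (S.vx 0 y)]; nlinarith [sq_nonneg (|S.vx 0 y| - 1)]
  rw [tInt_add (by fun_prop) (by fun_prop), tInt_const] at h5
  rw [S.mean_v] at h3
  linarith

lemma cv_pos (A : Admissible μ R a b κ₁ κ₂ β γ T M ε) : 0 < R / (γ - 1) :=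
  div_pos A.R_pos (by linarith [A.one_lt_γ])

theorem energy_bound (A : Admissible μ R a b κ₁ κ₂ β γ T M ε) :
    ∃ E : ℝ, 0 < E ∧ ∀ S : Sol μ R a b κ₁ κ₂ β γ T, S.Bounded M ε → ∀ t ∈ Icc (0 : ℝ) T,
      tInt (S.θ t) ≤ E ∧ tInt (fun x => S.u t x ^ 2) ≤ E := by
  have hc := cv_pos A
  set c := R / (γ - 1)
  set E₀ := c * (2 + 2 * M ^ 2) + M ^ 2 / 2 with hE₀
  have hE₀pos : 0 < E₀ := by positivity
  refine ⟨E₀ / c + 2 * E₀, by positivity, fun S hS t ht => ?_⟩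
  have h := S.energy_conserved ht
  obtain ⟨hu, -⟩ := S.initial_bounds A hS
  have hθ0 : tInt (S.θ 0) ≤ 2 + 2 * M ^ 2 := by
    rw [← tInt_const (2 + 2 * M ^ 2)]
    exact tInt_mono (by fun_prop) continuous_const fun x hx => S.initial_θ_le A hS hx
  have split : ∀ s, tInt (fun x => c * S.θ s x + S.u s x ^ 2 / 2)
      = c * tInt (S.θ s) + 1 / 2 * tInt (fun x => S.u s x ^ 2) := fun s => by
    rw [← tInt_const_mul, ← tInt_const_mul, ← tInt_add (by fun_prop) (by fun_prop)]
    exact tInt_congr fun x => by ring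
  rw [split, split] at h
  have hθn : 0 ≤ tInt (S.θ t) := tInt_nonneg fun x => (S.θ_pos t x).le
  have hun : 0 ≤ tInt (fun x => S.u t x ^ 2) := tInt_nonneg fun x => sq_nonneg _
  have h1 : c * tInt (S.θ 0) ≤ c * (2 + 2 * M ^ 2) := by gcongr
  have h2 : c * tInt (S.θ t) ≤ E₀ := by linarith
  have h3 := mul_nonneg hc.le hθn
  have h4 : tInt (S.θ t) ≤ E₀ / c := by
    rw [le_div_iff₀ hc]; linarith
  have h5 : 0 ≤ E₀ / c := by positivity
  exact ⟨by linarith, by linarith⟩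

end Sol

namespace Sol

variable {μ R a b κ₁ κ₂ β γ T M ε : ℝ}

/-! ### Bounds for the specific volume -/

/-- The spatial primitive of the velocity. -/
def prim (S : Sol μ R a b κ₁ κ₂ β γ T) (t x : ℝ) : ℝ := ∫ y in (0 : ℝ)..x, S.u t y

/-- The stress `μ u_x / v - R θ / v` at the origin. -/
def stress₀ (S : Sol μ R a b κ₁ κ₂ β γ T) (t : ℝ) : ℝ :=
  μ * S.ux t 0 / S.v t 0 - R * S.θ t 0 / S.v t 0

/-- The factor `exp (-(∫ u dx + ∫ stress₀ dt) / μ)` relating `v` to Kazhikhov's variable. -/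
def weight (S : Sol μ R a b κ₁ κ₂ β γ T) (t x : ℝ) : ℝ :=
  Real.exp (-(S.prim t x + ∫ s in (0 : ℝ)..t, S.stress₀ s) / μ)

lemma continuous_stress₀ (S : Sol μ R a b κ₁ κ₂ β γ T) : Continuous S.stress₀ := by
  unfold stress₀
  fun_prop (disch := simp)

lemma hasDerivAt_primitive {f : ℝ → ℝ} (hf : Continuous f) (t : ℝ) :
    HasDerivAt (fun r => ∫ s in (0 : ℝ)..r, f s) (f t) t :=
  intervalIntegral.integral_hasDerivAt_right (hf.intervalIntegrable _ _)
    hf.aestronglyMeasurable.stronglyMeasurableAtFilter hf.continuousAt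

lemma continuous_primitive₂ {F : ℝ → ℝ → ℝ} (hF : Continuous fun p : ℝ × ℝ => F p.1 p.2) :
    Continuous fun p : ℝ × ℝ => ∫ y in (0 : ℝ)..p.2, F p.1 y :=
  intervalIntegral.continuous_parametric_intervalIntegral_of_continuous
    (f := fun p : ℝ × ℝ => F p.1) (by simp only [Function.uncurry_def]; fun_prop) continuous_snd

lemma continuous_weight (S : Sol μ R a b κ₁ κ₂ β γ T) :
    Continuous fun p : ℝ × ℝ => S.weight p.1 p.2 := by
  have h1 := continuous_primitive₂ (F := S.u) (by fun_prop)
  have h2 : Continuous fun t => ∫ s in (0 : ℝ)..t, S.stress₀ s :=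
    continuous_iff_continuousAt.2 fun t =>
      (hasDerivAt_primitive S.continuous_stress₀ t).continuousAt
  unfold weight prim
  fun_prop

lemma hasDerivAt_v_mul_weight (S : Sol μ R a b κ₁ κ₂ β γ T) (t x : ℝ) :
    HasDerivAt (fun s => S.v s x * S.weight s x)
      (S.vt t x * S.weight t x + S.v t x * (S.weight t x *
        (-((∫ y in (0 : ℝ)..x, S.ut t y) + S.stress₀ t) / μ))) t :=
  (S.hasDerivAt_v_t t x).mul ((((hasDerivAt_integral (F := S.u) (F' := S.ut) (by fun_prop)
    (by fun_prop) (fun t x => S.hasDerivAt_u_t t x) 0 x t).add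
      (hasDerivAt_primitive S.continuous_stress₀ t)).neg.div_const μ).exp)

lemma v_mul_weight_deriv_eq (A : Admissible μ R a b κ₁ κ₂ β γ T M ε)
    (S : Sol μ R a b κ₁ κ₂ β γ T) {t : ℝ} (ht : t ∈ Icc 0 T) (x : ℝ) :
    S.vt t x * S.weight t x + S.v t x * (S.weight t x *
        (-((∫ y in (0 : ℝ)..x, S.ut t y) + S.stress₀ t) / μ))
      = R / μ * S.θ t x * S.weight t x := by
  have h : ∫ y in (0 : ℝ)..x, S.ut t y
      = (μ * S.ux t x / S.v t x - R * S.θ t x / S.v t x) - S.stress₀ t := by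
    have hc : Continuous (S.ut t) := by fun_prop
    rw [intervalIntegral.integral_eq_sub_of_hasDerivAt (fun y _ => S.ut_eq_deriv ht y)
      (hc.intervalIntegrable _ _), stress₀]
  rw [h, S.vt_eq ht]
  have := S.v_ne t x
  have := A.μ_pos.ne'
  field_simp
  ring

lemma abs_prim_le {E : ℝ} (S : Sol μ R a b κ₁ κ₂ β γ T) {t x : ℝ}
    (hE : tInt (fun x => S.u t x ^ 2) ≤ E) (hx : x ∈ Icc (-(1/2) : ℝ) (1/2)) :
    |S.prim t x| ≤ 1 + E := by
  have hc : Continuous (S.u t) := by fun_prop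
  have h := abs_sub_le_tInt (f := S.prim t) (hasDerivAt_primitive hc) hc hx
    (y := 0) (by norm_num)
  have h0 : S.prim t 0 = 0 := intervalIntegral.integral_same
  have h5 : (tInt fun x => |S.u t x|) ≤ tInt fun x => 1 + S.u t x ^ 2 :=
    tInt_mono (by fun_prop) (by fun_prop) fun y _ => by
      rw [← sq_abs (S.u t y)]; nlinarith [sq_nonneg (|S.u t y| - 1)]
  rw [tInt_add (by fun_prop) (by fun_prop), tInt_const] at h5
  rw [h0, sub_zero] at h
  linarith

/-- Lower bound for `v`, and an upper bound in terms of a majorant of `∫ sup θ`. -/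
theorem v_bounds (A : Admissible μ R a b κ₁ κ₂ β γ T M ε) :
    ∃ c C : ℝ, 0 < c ∧ 0 < C ∧ ∀ S : Sol μ R a b κ₁ κ₂ β γ T, S.Bounded M ε →
      (∀ t ∈ Icc (0 : ℝ) T, ∀ x ∈ Icc (-(1/2) : ℝ) (1/2), c ≤ S.v t x) ∧
      ∀ (h : ℝ → ℝ) (H : ℝ), Continuous h → (∀ t, 0 ≤ h t) →
        (∀ t ∈ Icc (0 : ℝ) T, ∀ x ∈ Icc (-(1/2) : ℝ) (1/2), S.θ t x ≤ h t) →
        (∀ t ∈ Icc (0 : ℝ) T, ∫ s in (0 : ℝ)..t, h s ≤ H) →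
        ∀ t ∈ Icc (0 : ℝ) T, ∀ x ∈ Icc (-(1/2) : ℝ) (1/2), S.v t x ≤ C * (1 + H) := by
  obtain ⟨E, hE0, hE⟩ := energy_bound A
  have hμ := A.μ_pos
  have hR := A.R_pos
  have hε := A.ε_pos
  have hT := A.T_pos
  set B := Real.exp ((1 + E) / μ) with hB
  have hB0 : 0 < B := Real.exp_pos _
  set K := R / μ * B ^ 2 * E with hK
  have hK0 : 0 < K := by positivity
  set L := B ^ 2 * Real.exp (K * T) with hL
  have hL0 : 0 < L := by positivity
  refine ⟨ε / B ^ 2 / L, B * (B ^ 2 / ε) * ((2 + M ^ 2) * B + R / μ * B * L),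
    by positivity, by positivity, fun S hS => ?_⟩
  set G : ℝ → ℝ := fun t => Real.exp ((∫ s in (0 : ℝ)..t, S.stress₀ s) / μ) with hG
  have hG0 : ∀ t, 0 < G t := fun t => Real.exp_pos _
  have hw0 : ∀ t x, 0 < S.weight t x := fun t x => Real.exp_pos _
  have hw : ∀ t x, S.weight t x * G t = Real.exp (-S.prim t x / μ) := fun t x => by
    rw [weight, hG, ← Real.exp_add]
    congr 1
    ring
  have hwB : ∀ t ∈ Icc (0 : ℝ) T, ∀ x ∈ Icc (-(1/2) : ℝ) (1/2),
      S.weight t x * G t ≤ B ∧ 1 ≤ B * (S.weight t x * G t) := fun t ht x hx => by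
    have h1 := abs_le.1 (S.abs_prim_le (hE S hS t ht).2 hx)
    rw [hw, hB, ← Real.exp_add]
    constructor
    · apply Real.exp_le_exp.2
      gcongr
      linarith
    · apply Real.one_le_exp
      rw [← add_div]
      apply div_nonneg _ hμ.le
      linarith
  have h0T : (0 : ℝ) ∈ Icc 0 T := ⟨le_rfl, hT.le⟩
  have hGz : G 0 = 1 := by simp [hG]
  have hmono : ∀ t ∈ Icc (0 : ℝ) T, ∀ x ∈ Icc (-(1/2) : ℝ) (1/2),
      S.v 0 x * S.weight 0 x ≤ S.v t x * S.weight t x := fun t ht x hx => by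
    refine (monotoneOn_of_hasDerivWithinAt_nonneg (convex_Icc 0 T)
      (f := fun s => S.v s x * S.weight s x)
      (fun s _ => (S.hasDerivAt_v_mul_weight s x).continuousAt.continuousWithinAt)
      (fun s _ => (S.hasDerivAt_v_mul_weight s x).hasDerivWithinAt) fun s hs => ?_) h0T ht ht.1
    rw [S.v_mul_weight_deriv_eq A (interior_subset hs)]
    have := hw0 s x
    have := S.θ_pos s x
    positivity
  have hinit : ∀ x ∈ Icc (-(1/2) : ℝ) (1/2), ε ≤ B * (S.v 0 x * S.weight 0 x) := fun x hx => by
    have h1 := (hwB 0 h0T x hx).2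
    rw [hGz, mul_one] at h1
    have h2 := hS.2.1 x
    nlinarith [mul_le_mul h2 h1 zero_le_one (hε.le.trans h2)]
  have hvG : ∀ t ∈ Icc (0 : ℝ) T, ∀ x ∈ Icc (-(1/2) : ℝ) (1/2),
      ε / B ^ 2 * G t ≤ S.v t x := fun t ht x hx => by
    rw [div_mul_eq_mul_div, div_le_iff₀ (by positivity)]
    have h1 := hmono t ht x hx
    have h2 := hinit x hx
    have h3 := (hwB t ht x hx).1
    calc ε * G t ≤ B * (S.v t x * S.weight t x) * G t := by
          have := hG0 t
          gcongr
          exact h2.trans (by gcongr)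
      _ = B * S.v t x * (S.weight t x * G t) := by ring
      _ ≤ B * S.v t x * B := by
          have := S.v_pos t x
          gcongr
      _ = S.v t x * B ^ 2 := by ring
  have hGle : ∀ t ∈ Icc (0 : ℝ) T, G t ≤ B ^ 2 / ε := fun t ht => by
    have h1 := tInt_mono continuous_const (g := S.v t) (by fun_prop) (hvG t ht)
    rw [tInt_const, S.tInt_v_eq_one ht, div_mul_eq_mul_div, div_le_one (by positivity)] at h1
    rw [le_div_iff₀ hε]
    linarith
  have hcw := S.continuous_weight
  have hcw' : ∀ t, Continuous (S.weight t) := fun t => by fun_prop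
  set y : ℝ → ℝ := fun t => tInt fun x => S.v t x * S.weight t x with hy
  have hyG : ∀ t ∈ Icc (0 : ℝ) T, 1 ≤ B * G t * y t := fun t ht => by
    rw [← S.tInt_v_eq_one ht, hy, ← tInt_const_mul]
    refine tInt_mono (by fun_prop) (by fun_prop) fun x hx => ?_
    have h1 := (hwB t ht x hx).2
    have := S.v_pos t x
    nlinarith
  have hcprim : Continuous fun p : ℝ × ℝ => ∫ y in (0 : ℝ)..p.2, S.ut p.1 y :=
    continuous_primitive₂ (by fun_prop)
  have hcs := S.continuous_stress₀
  have hyder : ∀ t ∈ Icc (0 : ℝ) T,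
      HasDerivAt y (tInt fun x => R / μ * S.θ t x * S.weight t x) t := fun t ht => by
    rw [← tInt_congr (S.v_mul_weight_deriv_eq A ht)]
    exact hasDerivAt_tInt (F := fun t x => S.v t x * S.weight t x)
      (F' := fun t x => S.vt t x * S.weight t x + S.v t x * (S.weight t x *
        (-((∫ y in (0 : ℝ)..x, S.ut t y) + S.stress₀ t) / μ)))
      (by fun_prop) (by fun_prop) S.hasDerivAt_v_mul_weight t
  have hyle : ∀ t ∈ Icc (0 : ℝ) T,
      (tInt fun x => R / μ * S.θ t x * S.weight t x) ≤ K * y t := fun t ht => by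
    have h1 : (tInt fun x => R / μ * S.θ t x * S.weight t x) * G t
        ≤ R / μ * B * tInt (S.θ t) := by
      rw [mul_comm, ← tInt_const_mul, ← tInt_const_mul]
      refine tInt_mono (by fun_prop) (by fun_prop) fun x hx => ?_
      have h2 := (hwB t ht x hx).1
      have := S.θ_pos t x
      calc G t * (R / μ * S.θ t x * S.weight t x)
          = R / μ * S.θ t x * (S.weight t x * G t) := by ring
        _ ≤ R / μ * S.θ t x * B := by gcongr
        _ = _ := by ring
    have h2 : R / μ * B * tInt (S.θ t) ≤ R / μ * B * E := by
      have := (hE S hS t ht).1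
      gcongr
    have h3 : R / μ * B * E ≤ K * y t * G t := by
      have := hyG t ht
      have h4 : 0 ≤ R / μ * B * E := by positivity
      calc R / μ * B * E = R / μ * B * E * 1 := by ring
        _ ≤ R / μ * B * E * (B * G t * y t) := by gcongr
        _ = K * y t * G t := by rw [hK]; ring
    exact le_of_mul_le_mul_right (h1.trans (h2.trans h3)) (hG0 t)
  have hy0 : y 0 ≤ B := by
    rw [← mul_one B, ← S.mean_v, hy, ← tInt_const_mul]
    refine tInt_mono (by fun_prop) (by fun_prop) fun x hx => ?_
    have h1 := (hwB 0 h0T x hx).1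
    rw [hGz, mul_one] at h1
    rw [mul_comm]
    have := S.v_pos 0 x
    gcongr
  have hyB : ∀ t ∈ Icc (0 : ℝ) T, y t ≤ B * Real.exp (K * T) := fun t ht => by
    have h := gronwall_dissip (D := fun _ => 0) (k := fun _ => K) (h := fun _ => 0) (H := 0)
      (K := K * T) hyder continuous_const continuous_const continuous_const (by simp)
      (fun _ => hK0.le) (by simp)
      (tInt_nonneg fun x => (mul_pos (S.v_pos 0 x) (hw0 0 x)).le)
      (fun s hs => by simpa using hyle s hs)
      (fun s hs => by
        simp only [intervalIntegral.integral_const, sub_zero, smul_eq_mul]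
        nlinarith [hs.2])
      (by simp) t ht
    simp only [intervalIntegral.integral_zero, add_zero] at h
    exact h.trans (by gcongr)
  have hGge : ∀ t ∈ Icc (0 : ℝ) T, 1 ≤ L * G t := fun t ht => by
    refine (hyG t ht).trans ?_
    calc B * G t * y t ≤ B * G t * (B * Real.exp (K * T)) := by
          have := hG0 t
          have := hyB t ht
          gcongr
      _ = L * G t := by rw [hL]; ring
  refine ⟨fun t ht x hx => ?_, fun h H hc hh0 hθ hH t ht x hx => ?_⟩
  · refine le_trans ?_ (hvG t ht x hx)
    rw [div_le_iff₀ hL0, mul_assoc]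
    exact le_mul_of_one_le_right (by positivity) (by linarith [hGge t ht])
  · have hH0 : 0 ≤ H := by simpa using hH 0 h0T
    have hwL : ∀ s ∈ Icc (0 : ℝ) T, S.weight s x ≤ B * L := fun s hs => by
      have h1 := (hwB s hs x hx).1
      have h2 := hGge s hs
      have h3 := hw0 s x
      calc S.weight s x = S.weight s x * 1 := by ring
        _ ≤ S.weight s x * (L * G s) := by gcongr
        _ = L * (S.weight s x * G s) := by ring
        _ ≤ L * B := by gcongr
        _ = B * L := by ring
    have key := gronwall_dissip (y := fun s => S.v s x * S.weight s x) (D := fun _ => 0)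
      (k := fun _ => 0) (h := fun s => R / μ * (B * L) * h s) (H := R / μ * (B * L) * H) (K := 0)
      (fun s _ => S.hasDerivAt_v_mul_weight s x) continuous_const continuous_const
      (by fun_prop) (by simp) (by simp)
      (fun s => mul_nonneg (by positivity) (hh0 s)) (mul_pos (S.v_pos 0 x) (hw0 0 x)).le
      (fun s hs => by
        rw [S.v_mul_weight_deriv_eq A hs]
        have h1 := hwL s hs
        have h2 := hθ s hs x hx
        have h3 := hw0 s x
        have h4 := hh0 s
        calc R / μ * S.θ s x * S.weight s x + 0 ≤ R / μ * h s * (B * L) := by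
              rw [add_zero]; gcongr
          _ = _ := by ring)
      (by simp)
      (fun s hs => by
        rw [intervalIntegral.integral_const_mul]
        exact mul_le_mul_of_nonneg_left (hH s hs) (by positivity)) t ht
    simp only [intervalIntegral.integral_zero, add_zero, Real.exp_zero, mul_one] at key
    have hz0 : S.v 0 x * S.weight 0 x ≤ (2 + M ^ 2) * B := by
      have h1 := (hwB 0 h0T x hx).1
      rw [hGz, mul_one] at h1
      have h2 := S.initial_v_le A hS hx
      have h3 := hw0 0 x
      gcongr
    have h1 := (hwB t ht x hx).2
    have h2 := S.v_pos t x
    have h3 := hw0 t x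
    have h4 := hGle t ht
    have h5 := hG0 t
    calc S.v t x = S.v t x * 1 := by ring
      _ ≤ S.v t x * (B * (S.weight t x * G t)) := by gcongr
      _ = B * G t * (S.v t x * S.weight t x) := by ring
      _ ≤ B * (B ^ 2 / ε) * ((2 + M ^ 2) * B + R / μ * (B * L) * H) := by
          gcongr
          linarith
      _ ≤ B * (B ^ 2 / ε) * (((2 + M ^ 2) * B + R / μ * B * L) * (1 + H)) := by
          gcongr
          have e1 : 0 ≤ (2 + M ^ 2) * B * H := by positivity
          have e2 : 0 ≤ R / μ * B * L := by positivity
          linarith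
      _ = _ := by ring

end Sol

namespace Sol

variable {μ R a b κ₁ κ₂ β γ T M ε : ℝ}

/-! ### Dissipation of the temperature -/

/-- A weighted one-dimensional Sobolev inequality for powers of the temperature. -/
lemma θ_rpow_le (S : Sol μ R a b κ₁ κ₂ β γ T) (t : ℝ) {m η : ℝ} (hm : 0 ≤ m) (hη : 0 < η)
    (s : ℝ) {x : ℝ} (hx : x ∈ Icc (-(1/2) : ℝ) (1/2)) :
    S.θ t x ^ m ≤ tInt (S.θ t) ^ m + (η * tInt (fun y => S.θ t y ^ s * S.θx t y ^ 2)
      + m ^ 2 / (4 * η) * tInt fun y => S.θ t y ^ (2 * (m - 1) - s)) := by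
  obtain ⟨z, hz, hle⟩ := exists_le_tInt (f := S.θ t) (by fun_prop)
  have h1 := (abs_le.1 (abs_sub_le_tInt (fun y => S.hasDerivAt_θ_rpow_x t y m) (by fun_prop)
    hx hz)).2
  have h2 : S.θ t z ^ m ≤ tInt (S.θ t) ^ m := rpow_le_rpow (S.θ_pos t z).le hle hm
  rw [← tInt_const_mul, ← tInt_const_mul, ← tInt_add (by fun_prop) (by fun_prop)]
  have h3 : (tInt fun y => |S.θx t y * m * S.θ t y ^ (m - 1)|) ≤ tInt fun y =>
      η * (S.θ t y ^ s * S.θx t y ^ 2) + m ^ 2 / (4 * η) * S.θ t y ^ (2 * (m - 1) - s) :=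
    tInt_mono (by fun_prop) (by fun_prop) fun y _ => by
      have hp := S.θ_pos t y
      have e1 : S.θ t y ^ (2 * (m - 1) - s) * S.θ t y ^ s = (S.θ t y ^ (m - 1)) ^ 2 := by
        rw [← rpow_add hp, ← rpow_natCast, ← rpow_mul hp.le]
        congr 1; push_cast; ring
      have p1 := rpow_pos_of_pos hp s
      have p2 := rpow_pos_of_pos hp (2 * (m - 1) - s)
      refine abs_le_of_sq_le_sq ?_ (by positivity)
      have e2 : (S.θx t y * m * S.θ t y ^ (m - 1)) ^ 2
          = 4 * (η * (S.θ t y ^ s * S.θx t y ^ 2))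
            * (m ^ 2 / (4 * η) * S.θ t y ^ (2 * (m - 1) - s)) := by
        rw [mul_pow, ← e1]
        field_simp
      rw [e2]
      nlinarith [sq_nonneg (η * (S.θ t y ^ s * S.θx t y ^ 2)
        - m ^ 2 / (4 * η) * S.θ t y ^ (2 * (m - 1) - s))]
  linarith

/-- The dissipation obtained by testing the temperature equation with `θ ^ (-δ)`. -/
def diss (S : Sol μ R a b κ₁ κ₂ β γ T) (δ t : ℝ) : ℝ :=
  tInt fun x => (κ₁ / S.v t x + κ₂ * S.θ t x ^ β) * S.θx t x ^ 2 * S.θ t x ^ (-δ - 1)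

lemma continuous_diss (S : Sol μ R a b κ₁ κ₂ β γ T) (δ : ℝ) : Continuous (S.diss δ) :=
  continuous_tInt (F := fun t x => (κ₁ / S.v t x + κ₂ * S.θ t x ^ β) * S.θx t x ^ 2
    * S.θ t x ^ (-δ - 1)) (by fun_prop (disch := simp))

lemma diss_nonneg (A : Admissible μ R a b κ₁ κ₂ β γ T M ε) (S : Sol μ R a b κ₁ κ₂ β γ T)
    (δ t : ℝ) : 0 ≤ S.diss δ t := tInt_nonneg fun x => by
  have := S.v_pos t x
  have := S.θ_pos t x
  have := A.κ₁_pos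
  have := A.κ₂_pos
  positivity

lemma tInt_le_diss (A : Admissible μ R a b κ₁ κ₂ β γ T M ε) (S : Sol μ R a b κ₁ κ₂ β γ T)
    (δ t : ℝ) : κ₂ * tInt (fun x => S.θ t x ^ (β - δ - 1) * S.θx t x ^ 2) ≤ S.diss δ t := by
  rw [← tInt_const_mul]
  refine tInt_mono (by fun_prop) (by fun_prop (disch := simp)) fun x _ => ?_
  have := S.v_pos t x
  have hθ := S.θ_pos t x
  have := A.κ₁_pos
  rw [show β - δ - 1 = β + (-δ - 1) by ring, rpow_add hθ]
  have : 0 ≤ κ₁ / S.v t x * S.θx t x ^ 2 * S.θ t x ^ (-δ - 1) := by positivity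
  linarith

lemma θ_le_diss (A : Admissible μ R a b κ₁ κ₂ β γ T M ε) (S : Sol μ R a b κ₁ κ₂ β γ T)
    {δ η E t x : ℝ} (hδ : δ ≤ β) (hη : 0 < η) (hE : tInt (S.θ t) ≤ E)
    (hx : x ∈ Icc (-(1/2) : ℝ) (1/2)) :
    S.θ t x ≤ 1 + E ^ (1 + (β - δ) / 2) + (1 + (β - δ) / 2) ^ 2 * κ₂⁻¹ / (4 * η) * E
      + η * S.diss δ t := by
  have hκ := A.κ₂_pos
  have hp := S.θ_pos t x
  set m := 1 + (β - δ) / 2 with hm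
  have hm1 : 1 ≤ m := by linarith
  have h0 : 0 ≤ tInt (S.θ t) := tInt_nonneg fun y => (S.θ_pos t y).le
  have h1 := S.θ_rpow_le t (by linarith : 0 ≤ m) (mul_pos hη hκ) (β - δ - 1) hx
  have e1 : 2 * (m - 1) - (β - δ - 1) = 1 := by rw [hm]; ring
  simp only [e1, rpow_one] at h1
  have h2 : S.θ t x ≤ 1 + S.θ t x ^ m := by
    rcases le_total (S.θ t x) 1 with h | h
    · have := rpow_nonneg hp.le m
      linarith
    · have := self_le_rpow_of_one_le h hm1
      linarith
  have h3 : tInt (S.θ t) ^ m ≤ E ^ m := rpow_le_rpow h0 hE (by linarith)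
  have h4 := mul_le_mul_of_nonneg_left (S.tInt_le_diss A δ t) hη.le
  have h5 : m ^ 2 / (4 * (η * κ₂)) * tInt (S.θ t) ≤ m ^ 2 * κ₂⁻¹ / (4 * η) * E := by
    have : m ^ 2 / (4 * (η * κ₂)) = m ^ 2 * κ₂⁻¹ / (4 * η) := by field_simp
    rw [this]
    gcongr
  linarith

lemma θ_rpow_le_one_add (S : Sol μ R a b κ₁ κ₂ β γ T) (t x : ℝ) {r s : ℝ} (hr : 0 ≤ r)
    (hrs : r ≤ s) : S.θ t x ^ r ≤ 1 + S.θ t x ^ s := by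
  have hp := S.θ_pos t x
  rcases le_total (S.θ t x) 1 with h | h
  · have h1 := rpow_nonneg hp.le s
    have h2 := rpow_le_one hp.le h hr
    linarith
  · have := rpow_le_rpow_of_exponent_le h hrs
    linarith

theorem diss_bound (A : Admissible μ R a b κ₁ κ₂ β γ T M ε) {δ : ℝ} (hδ0 : 0 < δ)
    (hδ1 : δ < 1) (hδβ : δ ≤ β) :
    ∃ C : ℝ, 0 < C ∧ ∀ S : Sol μ R a b κ₁ κ₂ β γ T, S.Bounded M ε → ∀ t ∈ Icc (0 : ℝ) T,
      ∫ s in (0 : ℝ)..t, S.diss δ s ≤ C := by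
  obtain ⟨E, hE0, hE⟩ := energy_bound A
  obtain ⟨c, _, hc0, _, hv⟩ := v_bounds A
  have hcv := cv_pos A
  have hμ := A.μ_pos
  have hκ := A.κ₂_pos
  have hT := A.T_pos
  set K := R ^ 2 / (4 * μ * c) * (1 + E) with hK
  have hK0 : 0 < K := by have := A.R_pos; positivity
  set η := δ / (2 * K) with hη
  have hη0 : 0 < η := by positivity
  set L := 1 + E ^ (1 + (β - δ) / 2) + (1 + (β - δ) / 2) ^ 2 * κ₂⁻¹ / (4 * η) * E with hL
  have hL0 : 0 < L := by positivity
  have hδ2 : 0 < 1 - δ := by linarith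
  set C₀ := R / (γ - 1) / (1 - δ) * (1 + E) with hC₀
  refine ⟨2 / δ * (C₀ + T * (K * L)), by positivity, fun S hS t ht => ?_⟩
  have hθE : ∀ s ∈ Icc 0 T, tInt (fun x => S.θ s x ^ (1 - δ)) ≤ 1 + E := fun s hs => by
    refine (tInt_mono (g := fun x => 1 + S.θ s x) (by fun_prop) (by fun_prop)
      fun x _ => ?_).trans ?_
    · simpa using S.θ_rpow_le_one_add s x hδ2.le (by linarith : 1 - δ ≤ 1)
    · rw [tInt_add (by fun_prop) (by fun_prop), tInt_const]
      linarith [(hE S hS s hs).1]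
  have hy0 : ∀ s ∈ Icc 0 T,
      0 ≤ C₀ - R / (γ - 1) / (1 - δ) * tInt (fun x => S.θ s x ^ (1 - δ)) := fun s hs => by
    have := mul_le_mul_of_nonneg_left (hθE s hs) (div_pos hcv hδ2).le
    linarith
  have hder : ∀ s, HasDerivAt
      (fun s => C₀ - R / (γ - 1) / (1 - δ) * tInt (fun x => S.θ s x ^ (1 - δ)))
      (-(R / (γ - 1) * tInt fun x => S.θt s x * S.θ s x ^ (-δ))) s := fun s => by
    have h := ((hasDerivAt_tInt (F := fun s x => S.θ s x ^ (1 - δ))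
      (F' := fun s x => S.θt s x * (1 - δ) * S.θ s x ^ (1 - δ - 1))
      (by fun_prop) (by fun_prop) (fun t x => S.hasDerivAt_θ_rpow_t t x (1 - δ)) s).const_mul
        (R / (γ - 1) / (1 - δ))).const_sub C₀
    refine h.congr_deriv ?_
    rw [← tInt_const_mul, ← tInt_const_mul]
    congr 1
    refine tInt_congr fun x => ?_
    rw [show 1 - δ - 1 = -δ by ring]
    field_simp
  have key := gronwall_dissip (D := fun s => δ / 2 * S.diss δ s) (k := fun _ => 0)
    (h := fun _ => K * L) (T := T) (K := 0) (H := T * (K * L)) (fun s _ => hder s)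
    ((S.continuous_diss δ).const_mul _) continuous_const continuous_const
    (fun s => mul_nonneg (by positivity) (S.diss_nonneg A δ s)) (fun _ => le_rfl)
    (fun _ => by positivity) (hy0 0 ⟨le_rfl, hT.le⟩)
    (fun s hs => by
      have hD := S.diss_nonneg A δ s
      have h1 := S.power_balance A hs (-δ)
      have h2 : tInt (fun x => -δ * (μ * S.ux s x ^ 2 / S.v s x - R * S.θ s x * S.ux s x / S.v s x)
          * S.θ s x ^ (-δ) - (-δ) ^ 2 * ((κ₁ / S.v s x + κ₂ * S.θ s x ^ β) * S.θx s x ^ 2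
          * S.θ s x ^ (-δ - 1))) ≤ tInt fun x => δ * (R ^ 2 / (4 * μ * c) * (L + η * S.diss δ s))
          * S.θ s x ^ (1 - δ) - δ ^ 2 * ((κ₁ / S.v s x + κ₂ * S.θ s x ^ β) * S.θx s x ^ 2
          * S.θ s x ^ (-δ - 1)) :=
        tInt_mono (by fun_prop (disch := simp)) (by fun_prop (disch := simp)) fun x hx => by
          have hp := S.θ_pos s x
          have hvp := S.v_pos s x
          have hvc := (hv S hS).1 s hs x hx
          have hq := rpow_pos_of_pos hp (-δ)
          have g1 := S.θ_le_diss A hδβ hη0 (hE S hS s hs).1 hx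
          have g2 : -(μ * S.ux s x ^ 2 / S.v s x - R * S.θ s x * S.ux s x / S.v s x)
              ≤ R ^ 2 / (4 * μ * c) * S.θ s x ^ 2 := by
            have g3 : -(μ * S.ux s x ^ 2 / S.v s x - R * S.θ s x * S.ux s x / S.v s x)
                ≤ R ^ 2 * S.θ s x ^ 2 / (4 * μ) / S.v s x := by
              rw [← sub_div, ← neg_div]
              gcongr
              rw [le_div_iff₀ (by positivity)]
              nlinarith [sq_nonneg (2 * μ * S.ux s x - R * S.θ s x)]
            refine g3.trans ?_
            rw [show R ^ 2 / (4 * μ * c) * S.θ s x ^ 2 = R ^ 2 * S.θ s x ^ 2 / (4 * μ) / c by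
              field_simp]
            gcongr
          have g4 : R ^ 2 / (4 * μ * c) * S.θ s x ^ 2 ≤ R ^ 2 / (4 * μ * c) *
              ((L + η * S.diss δ s) * S.θ s x) := by
            rw [sq (S.θ s x)]
            gcongr
          have g5 : S.θ s x ^ (1 - δ) = S.θ s x * S.θ s x ^ (-δ) := by
            rw [show 1 - δ = 1 + -δ by ring, rpow_add hp, rpow_one]
          rw [g5]
          have g6 := mul_le_mul_of_nonneg_left (g2.trans g4) (mul_pos hδ0 hq).le
          linarith
      have h2' : tInt (fun x => δ * (R ^ 2 / (4 * μ * c) * (L + η * S.diss δ s))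
          * S.θ s x ^ (1 - δ) - δ ^ 2 * ((κ₁ / S.v s x + κ₂ * S.θ s x ^ β) * S.θx s x ^ 2
          * S.θ s x ^ (-δ - 1))) = δ * (R ^ 2 / (4 * μ * c) * (L + η * S.diss δ s))
          * tInt (fun x => S.θ s x ^ (1 - δ)) - δ ^ 2 * S.diss δ s := by
        rw [tInt_sub (by fun_prop) (by fun_prop (disch := simp)), tInt_const_mul,
          tInt_const_mul, diss]
      rw [← tInt_const_mul]
      have h3 : tInt (fun x => -δ * (R / (γ - 1) * S.θt s x * S.θ s x ^ (-δ)))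
          = δ * -(tInt fun x => R / (γ - 1) * (S.θt s x * S.θ s x ^ (-δ))) := by
        rw [mul_neg, ← neg_mul, ← tInt_const_mul]
        exact tInt_congr fun x => by ring
      rw [h3] at h1
      have h4 : δ * (R ^ 2 / (4 * μ * c) * (L + η * S.diss δ s)) * tInt (fun x => S.θ s x ^ (1 - δ))
          ≤ δ * (R ^ 2 / (4 * μ * c) * (L + η * S.diss δ s)) * (1 + E) := by
        have := hθE s hs
        gcongr
      have h5 : δ * (R ^ 2 / (4 * μ * c) * (L + η * S.diss δ s)) * (1 + E)
          = δ * (K * L + δ / 2 * S.diss δ s) := by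
        have : K * η = δ / 2 := by rw [hη]; field_simp
        rw [← this, hK]
        ring
      have h7 := (h1.trans (h2.trans_eq h2')).trans (sub_le_sub_right h4 _)
      rw [h5, show δ ^ 2 * S.diss δ s = δ * (δ * S.diss δ s) by ring, ← mul_sub] at h7
      have h8 := le_of_mul_le_mul_left h7 hδ0
      linarith)
    (fun s _ => by simp) (fun s hs => by
      rw [intervalIntegral.integral_const, smul_eq_mul, sub_zero]
      have := hs.2
      gcongr)
    t ht
  rw [exp_zero, mul_one, intervalIntegral.integral_const_mul] at key
  have h1 := hy0 t ht
  have h2 : 0 ≤ tInt (fun x => S.θ 0 x ^ (1 - δ)) :=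
    tInt_nonneg fun x => rpow_nonneg (S.θ_pos 0 x).le _
  have h3 := mul_nonneg (div_pos hcv hδ2).le h2
  have h4 : δ / 2 * ∫ s in (0 : ℝ)..t, S.diss δ s ≤ C₀ + T * (K * L) := by linarith
  calc ∫ s in (0 : ℝ)..t, S.diss δ s = 2 / δ * (δ / 2 * ∫ s in (0 : ℝ)..t, S.diss δ s) := by
        field_simp
    _ ≤ _ := by gcongr

/-- The Fisher information of the temperature. -/
def fisher (S : Sol μ R a b κ₁ κ₂ β γ T) (t : ℝ) : ℝ := tInt fun x => S.θx t x ^ 2 / S.θ t x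

lemma continuous_fisher (S : Sol μ R a b κ₁ κ₂ β γ T) : Continuous S.fisher :=
  continuous_tInt (F := fun t x => S.θx t x ^ 2 / S.θ t x) (by fun_prop (disch := simp))

lemma fisher_nonneg (S : Sol μ R a b κ₁ κ₂ β γ T) (t : ℝ) : 0 ≤ S.fisher t :=
  tInt_nonneg fun x => div_nonneg (sq_nonneg _) (S.θ_pos t x).le

lemma θ_sq_le_fisher (S : Sol μ R a b κ₁ κ₂ β γ T) {E t x : ℝ} (hE : tInt (S.θ t) ≤ E)
    (hx : x ∈ Icc (-(1/2) : ℝ) (1/2)) : S.θ t x ^ 2 ≤ (1 + 2 * E) ^ 2 * (1 + S.fisher t) := by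
  have h0 : 0 ≤ tInt (S.θ t) := tInt_nonneg fun y => (S.θ_pos t y).le
  have hJ := S.fisher_nonneg t
  have hp := S.θ_pos t x
  set w := √(1 + S.fisher t) with hw
  have hw2 : w ^ 2 = 1 + S.fisher t := sq_sqrt (by linarith)
  have hw1 : 1 ≤ w := by rw [hw, one_le_sqrt]; linarith
  have hw0 : 0 < w := by linarith
  have h1 := S.θ_rpow_le t zero_le_one (inv_pos.2 hw0) (-1) hx
  have e1 : (2 * (1 - 1) - -1 : ℝ) = 1 := by norm_num
  have e2 : tInt (fun y => S.θ t y ^ (-1 : ℝ) * S.θx t y ^ 2) = S.fisher t :=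
    tInt_congr fun y => by rw [rpow_neg_one, div_eq_inv_mul]
  simp only [e1, e2, rpow_one] at h1
  have h2 : w⁻¹ * S.fisher t ≤ w := by
    rw [inv_mul_le_iff₀ hw0]; nlinarith
  have h3 : 1 ^ 2 / (4 * w⁻¹) * tInt (S.θ t) ≤ w * E := by
    have : 1 ^ 2 / (4 * w⁻¹) * tInt (S.θ t) = w * tInt (S.θ t) / 4 := by field_simp
    rw [this]
    nlinarith [mul_nonneg hw0.le h0, mul_le_mul_of_nonneg_left hE hw0.le]
  have h4 : S.θ t x ≤ (1 + 2 * E) * w := by nlinarith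
  rw [← hw2, ← mul_pow]
  exact pow_le_pow_left₀ hp.le h4 2

theorem basic_bounds (A : Admissible μ R a b κ₁ κ₂ β γ T M ε) :
    ∃ c C : ℝ, 0 < c ∧ 0 < C ∧ ∀ S : Sol μ R a b κ₁ κ₂ β γ T, S.Bounded M ε →
      ∀ t ∈ Icc (0 : ℝ) T, tInt (S.θ t) ≤ C ∧ tInt (fun x => S.u t x ^ 2) ≤ C ∧
        (∫ s in (0 : ℝ)..t, S.fisher s ≤ C) ∧ ∀ x ∈ Icc (-(1/2) : ℝ) (1/2),
          c ≤ S.v t x ∧ S.v t x ≤ C ∧ S.θ t x ^ 2 ≤ C * (1 + S.fisher t) := by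
  have hβ := A.β_pos
  have hκ₁ := A.κ₁_pos
  have hκ₂ := A.κ₂_pos
  have hT := A.T_pos
  obtain ⟨δ, hδ0, hδ1, hδβ⟩ : ∃ δ : ℝ, 0 < δ ∧ δ < 1 ∧ δ ≤ β :=
    ⟨min β (1 / 2), by positivity, (min_le_right _ _).trans_lt (by norm_num), min_le_left _ _⟩
  obtain ⟨E, hE0, hE⟩ := energy_bound A
  obtain ⟨c, V, hc0, hV0, hv⟩ := v_bounds A
  obtain ⟨D, hD0, hD⟩ := diss_bound A hδ0 hδ1 hδβ
  set L := 1 + E ^ (1 + (β - δ) / 2) + (1 + (β - δ) / 2) ^ 2 * κ₂⁻¹ / (4 * 1) * E with hL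
  have hL0 : 0 < L := by positivity
  set V' := V * (1 + (T * L + D)) with hV'
  have hV'0 : 0 < V' := by positivity
  set F := (V' / κ₁ + 1 / κ₂) * D
  have hF0 : 0 < F := by positivity
  have hFE : 0 < (1 + 2 * E) ^ 2 := by positivity
  refine ⟨c, E + V' + F + (1 + 2 * E) ^ 2, hc0, by positivity, fun S hS => ?_⟩
  have hvV : ∀ t ∈ Icc (0 : ℝ) T, ∀ x ∈ Icc (-(1/2) : ℝ) (1/2), S.v t x ≤ V' := by
    refine (hv S hS).2 (fun s => L + S.diss δ s) _
      (continuous_const.add (S.continuous_diss δ))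
      (fun s => by have := S.diss_nonneg A δ s; positivity)
      (fun s hs x hx => ?_) fun s hs => ?_
    · have := S.θ_le_diss A hδβ one_pos (hE S hS s hs).1 hx
      linarith
    · rw [intervalIntegral.integral_add (by simp)
        ((S.continuous_diss δ).intervalIntegrable _ _), intervalIntegral.integral_const,
        smul_eq_mul, sub_zero]
      have h1 := hD S hS s hs
      have h2 := hs.2
      gcongr
  have hFd : ∀ t ∈ Icc (0 : ℝ) T, S.fisher t ≤ (V' / κ₁ + 1 / κ₂) * S.diss δ t :=
    fun t ht => by
      rw [diss, ← tInt_const_mul]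
      refine tInt_mono (by fun_prop (disch := simp)) (by fun_prop (disch := simp)) fun x hx => ?_
      have hp := S.θ_pos t x
      have hvp := S.v_pos t x
      have h1 := hvV t ht x hx
      set X := S.θx t x ^ 2 * S.θ t x ^ (-δ - 1) with hX
      have hX0 : 0 ≤ X := by positivity
      have h2 : S.θx t x ^ 2 / S.θ t x = X * S.θ t x ^ δ := by
        rw [hX, mul_assoc, ← rpow_add hp, show -δ - 1 + δ = -1 by ring, rpow_neg_one,
          div_eq_mul_inv]
      have h3 := S.θ_rpow_le_one_add t x hδ0.le hδβ
      have h4 : 1 ≤ V' / κ₁ * (κ₁ / S.v t x) := by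
        rw [div_mul_div_cancel₀ hκ₁.ne', le_div_iff₀ hvp]
        linarith
      have h5 : 0 ≤ V' / κ₁ * (κ₂ * S.θ t x ^ β) := by positivity
      have h6 : 0 ≤ 1 / κ₂ * (κ₁ / S.v t x) := by positivity
      have h7 : 1 / κ₂ * (κ₂ * S.θ t x ^ β) = S.θ t x ^ β := by field_simp
      rw [h2, mul_assoc (κ₁ / S.v t x + κ₂ * S.θ t x ^ β), ← hX, ← mul_assoc, mul_comm]
      refine mul_le_mul_of_nonneg_right ?_ hX0
      linarith
  intro t ht
  refine ⟨by linarith [(hE S hS t ht).1], by linarith [(hE S hS t ht).2], ?_, fun x hx =>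
    ⟨(hv S hS).1 t ht x hx, by linarith [hvV t ht x hx], ?_⟩⟩
  · have h1 : ∫ s in (0 : ℝ)..t, S.fisher s
        ≤ ∫ s in (0 : ℝ)..t, (V' / κ₁ + 1 / κ₂) * S.diss δ s :=
      intervalIntegral.integral_mono_on ht.1 (S.continuous_fisher.intervalIntegrable _ _)
        (((S.continuous_diss δ).const_mul _).intervalIntegrable _ _)
        fun s hs => hFd s ⟨hs.1, hs.2.trans ht.2⟩
    rw [intervalIntegral.integral_const_mul] at h1
    have h2 : (V' / κ₁ + 1 / κ₂) * ∫ s in (0 : ℝ)..t, S.diss δ s ≤ F :=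
      mul_le_mul_of_nonneg_left (hD S hS t ht) (by positivity)
    linarith
  · refine (S.θ_sq_le_fisher (hE S hS t ht).1 hx).trans ?_
    have := S.fisher_nonneg t
    gcongr
    linarith

end Sol

lemma integral_affine_le {f : ℝ → ℝ} (hf : Continuous f) {c d C t T : ℝ} (hc : 0 ≤ c)
    (hd : 0 ≤ d) (ht : t ∈ Icc 0 T) (hC : ∫ s in (0 : ℝ)..t, f s ≤ C) :
    ∫ s in (0 : ℝ)..t, (c + d * f s) ≤ T * c + d * C := by
  rw [intervalIntegral.integral_add (by simp) ((hf.const_mul _).intervalIntegrable _ _),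
    intervalIntegral.integral_const, intervalIntegral.integral_const_mul, smul_eq_mul, sub_zero]
  have := ht.2
  gcongr

namespace Sol

variable {μ R a b κ₁ κ₂ β γ T M ε : ℝ}

/-! ### The gradient of the specific volume -/

/-- The effective velocity `μ (log v)_x - u`. -/
def effVel (S : Sol μ R a b κ₁ κ₂ β γ T) (t x : ℝ) : ℝ := μ * S.vx t x / S.v t x - S.u t x

lemma continuous_effVel (S : Sol μ R a b κ₁ κ₂ β γ T) :
    Continuous fun p : ℝ × ℝ => S.effVel p.1 p.2 := by
  simp only [effVel]
  fun_prop (disch := simp)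

/-- The derivative of the effective velocity along smooth functions, before using the equations. -/
def effVelt (S : Sol μ R a b κ₁ κ₂ β γ T) (t x : ℝ) : ℝ :=
  (μ * S.vtx t x * S.v t x - μ * S.vx t x * S.vt t x) / S.v t x ^ 2 - S.ut t x

lemma hasDerivAt_effVel (S : Sol μ R a b κ₁ κ₂ β γ T) (t x : ℝ) :
    HasDerivAt (fun s => S.effVel s x) (S.effVelt t x) t :=
  (((S.hasDerivAt_vx_t t x).const_mul μ).div (S.hasDerivAt_v_t t x) (S.v_ne t x)).sub
    (S.hasDerivAt_u_t t x)

lemma effVelt_eq (A : Admissible μ R a b κ₁ κ₂ β γ T M ε) (S : Sol μ R a b κ₁ κ₂ β γ T) {t : ℝ}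
    (ht : t ∈ Icc 0 T) (x : ℝ) :
    S.effVelt t x = R / S.v t x * (S.θx t x - S.θ t x * (S.effVel t x + S.u t x) / μ) := by
  have := S.v_ne t x
  have := A.μ_pos.ne'
  rw [effVelt, effVel, S.vtx_eq ht, S.vt_eq ht, S.ut_eq ht]
  field_simp
  ring

theorem vx_bound (A : Admissible μ R a b κ₁ κ₂ β γ T M ε) :
    ∃ C : ℝ, 0 < C ∧ ∀ S : Sol μ R a b κ₁ κ₂ β γ T, S.Bounded M ε → ∀ t ∈ Icc (0 : ℝ) T,
      tInt (fun x => S.vx t x ^ 2) ≤ C := by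
  obtain ⟨c, C, hc0, hC0, hB⟩ := basic_bounds A
  have hμ := A.μ_pos
  have hR := A.R_pos
  have hT := A.T_pos
  have hM : 0 < M := by linarith [A.one_le_M]
  set d₀ := R / c * ((1 + C) * C / μ) with hd₀
  set d₁ := R / c * (μ + C * C / μ) with hd₁
  set W₀ := 2 * (μ / c) ^ 2 * M ^ 2 + 2 * M ^ 2 with hW₀
  refine ⟨2 * (C / μ) ^ 2 * (W₀ + (T * d₀ + d₁ * C) + C), by positivity, fun S hS t ht => ?_⟩
  have hcW := S.continuous_effVel
  have hcWx : ∀ s, Continuous (S.effVel s) := fun s => by fun_prop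
  have hcW' : Continuous fun p : ℝ × ℝ => S.effVelt p.1 p.2 := by
    simp only [effVelt]
    fun_prop (disch := simp)
  have hcWx' : ∀ s, Continuous (S.effVelt s) := fun s => by fun_prop
  have key := gronwall_dissip (y := fun s => tInt fun x => S.effVel s x ^ 2)
    (y' := fun s => tInt fun x => 2 * S.effVel s x * S.effVelt s x)
    (D := fun _ => 0) (k := fun _ => 0) (h := fun s => d₀ + d₁ * S.fisher s) (T := T) (K := 0)
    (H := T * d₀ + d₁ * C)
    (fun s _ => hasDerivAt_tInt (F := fun s x => S.effVel s x ^ 2)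
      (F' := fun s x => 2 * S.effVel s x * S.effVelt s x) (by fun_prop) (by fun_prop)
      (fun s x => ((S.hasDerivAt_effVel s x).pow 2).congr_deriv (by norm_num)) s)
    continuous_const continuous_const (continuous_const.add (S.continuous_fisher.const_mul _))
    (fun _ => le_rfl) (fun _ => le_rfl)
    (fun s => by have := S.fisher_nonneg s; positivity)
    (tInt_nonneg fun x => sq_nonneg _)
    (fun s hs => by
      obtain ⟨hθ, hu, hJ, hx⟩ := hB S hS s hs
      have hJ0 := S.fisher_nonneg s
      have h1 : (tInt fun x => 2 * S.effVel s x * S.effVelt s x)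
          ≤ tInt fun x => R / c * μ * (S.θx s x ^ 2 / S.θ s x)
            + R / c * ((1 + C * (1 + S.fisher s)) / μ) * S.u s x ^ 2 :=
        tInt_mono (by fun_prop) (by fun_prop (disch := simp)) fun x hxI => by
          obtain ⟨hvc, -, hθx⟩ := hx x hxI
          have hp := S.θ_pos s x
          have hvp := S.v_pos s x
          rw [S.effVelt_eq A hs]
          set W := S.effVel s x
          set w := S.θx s x
          set θ := S.θ s x
          set u := S.u s x
          have g1 : 2 * W * (w - θ * (W + u) / μ) ≤ μ * (w ^ 2 / θ) + θ * u ^ 2 / μ := by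
            have e : μ * (w ^ 2 / θ) + θ * u ^ 2 / μ - 2 * W * (w - θ * (W + u) / μ)
                = ((μ * w - θ * W) ^ 2 + θ ^ 2 * (W + u) ^ 2) / (θ * μ) := by
              field_simp
              ring
            have : 0 ≤ ((μ * w - θ * W) ^ 2 + θ ^ 2 * (W + u) ^ 2) / (θ * μ) := by positivity
            linarith
          have g2 : θ ≤ 1 + C * (1 + S.fisher s) := by nlinarith [sq_nonneg (θ - 1)]
          have g3 : μ * (w ^ 2 / θ) + θ * u ^ 2 / μ
              ≤ μ * (w ^ 2 / θ) + (1 + C * (1 + S.fisher s)) * u ^ 2 / μ := by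
            gcongr
          calc 2 * W * (R / S.v s x * (w - θ * (W + u) / μ))
              = R / S.v s x * (2 * W * (w - θ * (W + u) / μ)) := by ring
            _ ≤ R / S.v s x * (μ * (w ^ 2 / θ) + (1 + C * (1 + S.fisher s)) * u ^ 2 / μ) := by
                have := g1.trans g3
                gcongr
            _ ≤ R / c * (μ * (w ^ 2 / θ) + (1 + C * (1 + S.fisher s)) * u ^ 2 / μ) := by
                gcongr
            _ = _ := by ring
      rw [tInt_add (by fun_prop (disch := simp)) (by fun_prop), tInt_const_mul,
        tInt_const_mul] at h1
      have h2 : R / c * ((1 + C * (1 + S.fisher s)) / μ) * tInt (fun x => S.u s x ^ 2)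
          ≤ R / c * ((1 + C * (1 + S.fisher s)) / μ) * C := by gcongr
      have h3 : R / c * μ * (tInt fun x => S.θx s x ^ 2 / S.θ s x)
          + R / c * ((1 + C * (1 + S.fisher s)) / μ) * C = d₀ + d₁ * S.fisher s := by
        rw [hd₀, hd₁, fisher]
        ring
      linarith)
    (fun s _ => by simp)
    (fun s hs => integral_affine_le S.continuous_fisher (by positivity) (by positivity) hs
      (hB S hS s hs).2.2.1)
    t ht
  rw [exp_zero, mul_one, intervalIntegral.integral_const, smul_zero, add_zero] at key
  have h0 : tInt (fun x => S.effVel 0 x ^ 2) ≤ W₀ := by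
    have h1 : tInt (fun x => S.effVel 0 x ^ 2)
        ≤ tInt fun x => 2 * (μ / c) ^ 2 * S.vx 0 x ^ 2 + 2 * S.u 0 x ^ 2 :=
      tInt_mono (by fun_prop) (by fun_prop) fun x hxI => by
        have hvc := ((hB S hS 0 ⟨le_rfl, hT.le⟩).2.2.2 x hxI).1
        have hvp := S.v_pos 0 x
        have g1 : (μ * S.vx 0 x / S.v 0 x) ^ 2 ≤ (μ / c) ^ 2 * S.vx 0 x ^ 2 := by
          rw [mul_div_right_comm, mul_pow]
          gcongr
        rw [effVel]
        nlinarith [sq_nonneg (μ * S.vx 0 x / S.v 0 x + S.u 0 x)]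
    rw [tInt_add (by fun_prop) (by fun_prop), tInt_const_mul, tInt_const_mul] at h1
    obtain ⟨b1, -, b2, -⟩ := S.initial_bounds A hS
    refine h1.trans ?_
    rw [hW₀]
    gcongr
  obtain ⟨-, hu, -, hx⟩ := hB S hS t ht
  have h1 : tInt (fun x => S.vx t x ^ 2)
      ≤ tInt fun x => 2 * (C / μ) ^ 2 * (S.effVel t x ^ 2 + S.u t x ^ 2) :=
    tInt_mono (by fun_prop) (by fun_prop) fun x hxI => by
      obtain ⟨-, hvC, -⟩ := hx x hxI
      have hvp := S.v_pos t x
      have e : S.vx t x = S.v t x / μ * (S.effVel t x + S.u t x) := by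
        rw [effVel]
        field_simp
        ring
      calc S.vx t x ^ 2 = (S.v t x / μ) ^ 2 * (S.effVel t x + S.u t x) ^ 2 := by
            rw [e, mul_pow]
        _ ≤ (C / μ) ^ 2 * (2 * (S.effVel t x ^ 2 + S.u t x ^ 2)) := by
            gcongr
            nlinarith [sq_nonneg (S.effVel t x - S.u t x)]
        _ = _ := by ring
  rw [tInt_const_mul, tInt_add (by fun_prop) (by fun_prop)] at h1
  refine h1.trans ?_
  gcongr
  linarith

/-! ### The velocity gradient -/

/-- Testing the temperature equation with `θ ^ r`, given pointwise bounds. -/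
lemma power_estimate (A : Admissible μ R a b κ₁ κ₂ β γ T M ε) (S : Sol μ R a b κ₁ κ₂ β γ T)
    {t r c V N Q : ℝ} (ht : t ∈ Icc 0 T) (hr : 0 < r) (hc : 0 < c)
    (hv : ∀ x ∈ Icc (-(1/2) : ℝ) (1/2), c ≤ S.v t x ∧ S.v t x ≤ V)
    (hN : ∀ x ∈ Icc (-(1/2) : ℝ) (1/2), S.ux t x ^ 2 ≤ N)
    (hQ : ∀ x ∈ Icc (-(1/2) : ℝ) (1/2), S.θ t x ^ 2 ≤ Q) :
    R / (γ - 1) * tInt (fun x => S.θt t x * S.θ t x ^ r)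
      + r * (κ₁ / V) * tInt (fun x => S.θ t x ^ (r - 1) * S.θx t x ^ 2)
      ≤ ((μ + R) * N + R * Q) / c * tInt (fun x => S.θ t x ^ r) := by
  have hμ := A.μ_pos
  have hR := A.R_pos
  have hκ₁ := A.κ₁_pos
  have hκ₂ := A.κ₂_pos
  have h1 := S.power_balance A ht r
  have h2 : tInt (fun x => r * (μ * S.ux t x ^ 2 / S.v t x - R * S.θ t x * S.ux t x / S.v t x)
        * S.θ t x ^ r
        - r ^ 2 * ((κ₁ / S.v t x + κ₂ * S.θ t x ^ β) * S.θx t x ^ 2 * S.θ t x ^ (r - 1)))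
      ≤ tInt fun x => r * (((μ + R) * N + R * Q) / c) * S.θ t x ^ r
        - r ^ 2 * (κ₁ / V) * (S.θ t x ^ (r - 1) * S.θx t x ^ 2) :=
    tInt_mono (by fun_prop (disch := simp)) (by fun_prop) fun x hx => by
      have hp := S.θ_pos t x
      have hvp := S.v_pos t x
      have hn := hN x hx
      have hq := hQ x hx
      obtain ⟨hvc, hvV⟩ := hv x hx
      have g1 : μ * S.ux t x ^ 2 / S.v t x - R * S.θ t x * S.ux t x / S.v t x
          ≤ ((μ + R) * N + R * Q) / c := by
        have g0 : 0 ≤ (μ + R) * N + R * Q := by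
          have := (sq_nonneg _).trans hn
          have := (sq_nonneg _).trans hq
          positivity
        rw [← sub_div]
        refine (div_le_div_of_nonneg_right (?_ : _ ≤ (μ + R) * N + R * Q) hvp.le).trans
          (by gcongr)
        nlinarith [mul_le_mul_of_nonneg_left hn hμ.le, mul_le_mul_of_nonneg_left hn hR.le,
          mul_le_mul_of_nonneg_left hq hR.le,
          mul_nonneg hR.le (sq_nonneg (S.θ t x + S.ux t x)), mul_nonneg hR.le (sq_nonneg (S.θ t x)),
          mul_nonneg hR.le (sq_nonneg (S.ux t x))]
      have g2 : κ₁ / V ≤ κ₁ / S.v t x + κ₂ * S.θ t x ^ β := by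
        have : κ₁ / V ≤ κ₁ / S.v t x := by gcongr
        have : 0 ≤ κ₂ * S.θ t x ^ β := by positivity
        linarith
      have g3 : r * (μ * S.ux t x ^ 2 / S.v t x - R * S.θ t x * S.ux t x / S.v t x) * S.θ t x ^ r
          ≤ r * (((μ + R) * N + R * Q) / c) * S.θ t x ^ r := by gcongr
      have g4 : r ^ 2 * (κ₁ / V) * (S.θ t x ^ (r - 1) * S.θx t x ^ 2)
          ≤ r ^ 2 * (κ₁ / S.v t x + κ₂ * S.θ t x ^ β) * (S.θ t x ^ (r - 1) * S.θx t x ^ 2) := by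
        gcongr
      linarith
  have h2' : tInt (fun x => r * (((μ + R) * N + R * Q) / c) * S.θ t x ^ r
      - r ^ 2 * (κ₁ / V) * (S.θ t x ^ (r - 1) * S.θx t x ^ 2))
      = r * (((μ + R) * N + R * Q) / c) * tInt (fun x => S.θ t x ^ r)
        - r ^ 2 * (κ₁ / V) * tInt (fun x => S.θ t x ^ (r - 1) * S.θx t x ^ 2) := by
    rw [tInt_sub (by fun_prop) (by fun_prop), tInt_const_mul, tInt_const_mul]
  rw [h2'] at h2
  rw [tInt_const_mul] at h1
  have h3 : (tInt fun x => R / (γ - 1) * S.θt t x * S.θ t x ^ r)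
      = R / (γ - 1) * tInt fun x => S.θt t x * S.θ t x ^ r := by
    rw [← tInt_const_mul]
    exact tInt_congr fun x => by ring
  rw [h3] at h1
  refine le_of_mul_le_mul_left ?_ hr
  linarith

/-- Testing the momentum equation with `-u_xx`, given pointwise bounds. -/
lemma velocity_estimate (A : Admissible μ R a b κ₁ κ₂ β γ T M ε) (S : Sol μ R a b κ₁ κ₂ β γ T)
    {t c V N Q : ℝ} (ht : t ∈ Icc 0 T) (hc : 0 < c)
    (hv : ∀ x ∈ Icc (-(1/2) : ℝ) (1/2), c ≤ S.v t x ∧ S.v t x ≤ V)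
    (hN : ∀ x ∈ Icc (-(1/2) : ℝ) (1/2), S.ux t x ^ 2 ≤ N)
    (hQ : ∀ x ∈ Icc (-(1/2) : ℝ) (1/2), S.θ t x ^ 2 ≤ Q) :
    tInt (fun x => S.ux t x * S.utx t x) + μ / (2 * V) * tInt (fun x => S.uxx t x ^ 2)
      ≤ 3 / (2 * μ * c) * ((μ ^ 2 * N + R ^ 2 * Q) / c ^ 2) * tInt (fun x => S.vx t x ^ 2)
        + 3 / (2 * μ * c) * R ^ 2 * tInt (fun x => S.θx t x ^ 2) := by
  have hμ := A.μ_pos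
  have hR := A.R_pos
  have h := tInt_le_of_flux
    (f := fun x => S.ux t x * S.utx t x + μ / (2 * V) * S.uxx t x ^ 2)
    (h := fun x => 3 / (2 * μ * c) * ((μ ^ 2 * N + R ^ 2 * Q) / c ^ 2) * S.vx t x ^ 2
        + 3 / (2 * μ * c) * R ^ 2 * S.θx t x ^ 2)
    (G := fun x => S.ux t x * S.ut t x)
    (by fun_prop) (by fun_prop)
    (fun x => (S.hasDerivAt_ux_x t x).mul (S.hasDerivAt_ut_x t x)) (by fun_prop)
    (fun x => by simp only [S.periodic_ux t x, S.periodic_ut t x])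
    (fun x hx => by
      have hvp := S.v_pos t x
      have hn := hN x hx
      have hq := hQ x hx
      obtain ⟨hvc, hvV⟩ := hv x hx
      have hN0 := (sq_nonneg _).trans hn
      have hQ0 := (sq_nonneg _).trans hq
      rw [S.ut_eq ht]
      set v := S.v t x
      set w := S.vx t x
      set z := S.uxx t x
      set θ := S.θ t x
      set p := S.θx t x
      set e := S.ux t x
      have g1 : -(z * (μ * (z / v - e * w / v ^ 2) - R * (p / v - θ * w / v ^ 2)))
          ≤ (-(μ / 2 * z ^ 2) + 3 / (2 * μ) * ((μ ^ 2 * e ^ 2 + R ^ 2 * θ ^ 2) / v ^ 2 * w ^ 2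
            + R ^ 2 * p ^ 2)) / v := by
        have i1 : -(z * (μ * (z / v - e * w / v ^ 2) - R * (p / v - θ * w / v ^ 2)))
            = (-(μ * z ^ 2) + z * (μ * e * (w / v) + R * p - R * θ * (w / v))) / v := by
          field_simp
          ring
        rw [i1]
        refine div_le_div_of_nonneg_right ?_ hvp.le
        set q := w / v
        have i2 : (μ ^ 2 * e ^ 2 + R ^ 2 * θ ^ 2) / v ^ 2 * w ^ 2
            = (μ * e * q) ^ 2 + (R * θ * q) ^ 2 := by
          simp only [q]
          field_simp
        rw [i2, show R ^ 2 * p ^ 2 = (R * p) ^ 2 by ring]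
        generalize μ * e * q = X
        generalize R * θ * q = Y
        generalize R * p = Z
        have i3 : -(μ / 2 * z ^ 2) + 3 / (2 * μ) * (X ^ 2 + Y ^ 2 + Z ^ 2)
            - (-(μ * z ^ 2) + z * (X + Z - Y))
            = ((μ * z - (X + Z - Y)) ^ 2 + ((X + Y) ^ 2 + (Y + Z) ^ 2 + (X - Z) ^ 2)) / (2 * μ) := by
          field_simp
          ring
        have : 0 ≤ ((μ * z - (X + Z - Y)) ^ 2 + ((X + Y) ^ 2 + (Y + Z) ^ 2 + (X - Z) ^ 2))
            / (2 * μ) := by positivity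
        linarith
      have g2 : (μ ^ 2 * e ^ 2 + R ^ 2 * θ ^ 2) / v ^ 2 ≤ (μ ^ 2 * N + R ^ 2 * Q) / c ^ 2 := by
        gcongr
      have g3 : 3 / (2 * μ) * ((μ ^ 2 * e ^ 2 + R ^ 2 * θ ^ 2) / v ^ 2 * w ^ 2
            + R ^ 2 * p ^ 2) / v
          ≤ 3 / (2 * μ) * ((μ ^ 2 * N + R ^ 2 * Q) / c ^ 2 * w ^ 2 + R ^ 2 * p ^ 2) / c := by
        gcongr
      have g4 : μ / (2 * V) * z ^ 2 ≤ μ / 2 * z ^ 2 / v := by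
        rw [show μ / 2 * z ^ 2 / v = μ / (2 * v) * z ^ 2 by field_simp]
        gcongr
      have g5 : 3 / (2 * μ) * ((μ ^ 2 * N + R ^ 2 * Q) / c ^ 2 * w ^ 2 + R ^ 2 * p ^ 2) / c
          = 3 / (2 * μ * c) * ((μ ^ 2 * N + R ^ 2 * Q) / c ^ 2) * w ^ 2
            + 3 / (2 * μ * c) * R ^ 2 * p ^ 2 := by
        field_simp
      rw [add_div, neg_div] at g1
      linarith)
  rwa [tInt_add (by fun_prop) (by fun_prop), tInt_add (by fun_prop) (by fun_prop),
    tInt_const_mul, tInt_const_mul, tInt_const_mul] at h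

lemma ux_sq_le (S : Sol μ R a b κ₁ κ₂ β γ T) {t x η : ℝ} (hη : 0 < η)
    (hx : x ∈ Icc (-(1/2) : ℝ) (1/2)) :
    S.ux t x ^ 2 ≤ (1 + 1 / η) * tInt (fun y => S.ux t y ^ 2)
      + η * tInt fun y => S.uxx t y ^ 2 := by
  have h := le_tInt_add_tInt_abs_deriv (f := fun y => S.ux t y ^ 2)
    (f' := fun y => 2 * S.ux t y * S.uxx t y)
    (fun y => ((S.hasDerivAt_ux_x t y).pow 2).congr_deriv (by norm_num)) (by fun_prop) hx
  have h2 : (tInt fun y => |2 * S.ux t y * S.uxx t y|)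
      ≤ tInt fun y => 1 / η * S.ux t y ^ 2 + η * S.uxx t y ^ 2 :=
    tInt_mono (by fun_prop) (by fun_prop) fun y _ => by
      have e1 : 1 / η * S.ux t y ^ 2 + η * S.uxx t y ^ 2 - 2 * S.ux t y * S.uxx t y
          = (S.ux t y - η * S.uxx t y) ^ 2 / η := by field_simp; ring
      have e2 : 1 / η * S.ux t y ^ 2 + η * S.uxx t y ^ 2 + 2 * S.ux t y * S.uxx t y
          = (S.ux t y + η * S.uxx t y) ^ 2 / η := by field_simp; ring
      have p1 : 0 ≤ (S.ux t y - η * S.uxx t y) ^ 2 / η := by positivity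
      have p2 : 0 ≤ (S.ux t y + η * S.uxx t y) ^ 2 / η := by positivity
      exact abs_le.2 ⟨by linarith, by linarith⟩
  rw [tInt_add (by fun_prop) (by fun_prop), tInt_const_mul, tInt_const_mul] at h2
  linarith

theorem ux_bound (A : Admissible μ R a b κ₁ κ₂ β γ T M ε) :
    ∃ C : ℝ, 0 < C ∧ ∀ S : Sol μ R a b κ₁ κ₂ β γ T, S.Bounded M ε →
      ∃ N : ℝ → ℝ, Continuous N ∧ (∀ t, 0 ≤ N t) ∧ ∀ t ∈ Icc (0 : ℝ) T,
        ∫ s in (0 : ℝ)..t, N s ≤ C ∧ ∀ x ∈ Icc (-(1/2) : ℝ) (1/2), S.ux t x ^ 2 ≤ N t := by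
  obtain ⟨c, C, hc0, hC0, hB⟩ := basic_bounds A
  obtain ⟨D, hD0, hD⟩ := vx_bound A
  have hμ := A.μ_pos
  have hR := A.R_pos
  have hκ₁ := A.κ₁_pos
  have hT := A.T_pos
  have hcv := cv_pos A
  have hM : 0 < M := by linarith [A.one_le_M]
  set L := 3 / (2 * μ * c) with hL
  have hL0 : 0 < L := by positivity
  set K := L * R ^ 2 * C / κ₁ with hK
  have hK0 : 0 < K := by positivity
  set G := L * μ ^ 2 / c ^ 2 * D + K * (μ + R) / c * C with hG
  have hG0 : 0 < G := by positivity
  set H := L * R ^ 2 / c ^ 2 * D + K * R / c * C with hH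
  have hH0 : 0 < H := by positivity
  set η := μ / (4 * C * G) with hη
  have hη0 : 0 < η := by positivity
  set k := 2 * G * (1 + 1 / η) with hk
  have hk0 : 0 < k := by positivity
  set Y := (1 / 2 * M ^ 2 + K * (R / (γ - 1)) / 2 * M ^ 2 + (T * (H * C) + H * C * C))
    * Real.exp (T * k) with hY
  have hY0 : 0 < Y := by positivity
  refine ⟨T * (4 * Y) + 4 * C / μ * Y, by positivity, fun S hS => ?_⟩
  have hcA : Continuous fun s => tInt fun x => S.ux s x ^ 2 :=
    continuous_tInt (F := fun s x => S.ux s x ^ 2) (by fun_prop)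
  have hcB : Continuous fun s => tInt fun x => S.uxx s x ^ 2 :=
    continuous_tInt (F := fun s x => S.uxx s x ^ 2) (by fun_prop)
  have hA0 : ∀ s, 0 ≤ tInt fun x => S.ux s x ^ 2 := fun s => tInt_nonneg fun x => sq_nonneg _
  have hB0 : ∀ s, 0 ≤ tInt fun x => S.uxx s x ^ 2 := fun s => tInt_nonneg fun x => sq_nonneg _
  have hθ0 : ∀ s, 0 ≤ tInt fun x => S.θ s x ^ 2 := fun s => tInt_nonneg fun x => sq_nonneg _
  have key := gronwall_dissip
    (y := fun s => 1 / 2 * tInt (fun x => S.ux s x ^ 2)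
      + K * (R / (γ - 1)) / 2 * tInt fun x => S.θ s x ^ 2)
    (y' := fun s => tInt (fun x => S.ux s x * S.utx s x)
      + K * (R / (γ - 1) * tInt fun x => S.θt s x * S.θ s x ^ (1 : ℝ)))
    (D := fun s => μ / (4 * C) * tInt fun x => S.uxx s x ^ 2) (k := fun _ => k)
    (h := fun s => H * C + H * C * S.fisher s) (T := T) (K := T * k)
    (H := T * (H * C) + H * C * C)
    (fun s _ => by
      have d1 := (hasDerivAt_tInt (F := fun s x => S.ux s x ^ 2)
        (F' := fun s x => 2 * (S.ux s x * S.utx s x)) (by fun_prop) (by fun_prop)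
        (fun s x => ((S.hasDerivAt_ux_t s x).pow 2).congr_deriv (by norm_num; ring)) s).const_mul
          (1 / 2)
      have d2 := (hasDerivAt_tInt (F := fun s x => S.θ s x ^ 2)
        (F' := fun s x => 2 * (S.θt s x * S.θ s x ^ (1 : ℝ))) (by fun_prop) (by fun_prop)
        (fun s x => ((S.hasDerivAt_θ_t s x).pow 2).congr_deriv
          (by rw [rpow_one]; norm_num; ring)) s).const_mul (K * (R / (γ - 1)) / 2)
      refine (d1.add d2).congr_deriv ?_
      rw [tInt_const_mul, tInt_const_mul]
      ring)
    (hcB.const_mul _) continuous_const (continuous_const.add (S.continuous_fisher.const_mul _))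
    (fun s => mul_nonneg (by positivity) (hB0 s)) (fun _ => hk0.le)
    (fun s => by have := S.fisher_nonneg s; positivity)
    (by have := hA0 0; have := hθ0 0; positivity)
    (fun s hs => by
      obtain ⟨hθ, -, -, hx⟩ := hB S hS s hs
      have hJ0 := S.fisher_nonneg s
      have a0 := hA0 s
      have b0 := hB0 s
      have hv : ∀ x ∈ Icc (-(1/2) : ℝ) (1/2), c ≤ S.v s x ∧ S.v s x ≤ C :=
        fun x hxI => ⟨(hx x hxI).1, (hx x hxI).2.1⟩
      have hQ : ∀ x ∈ Icc (-(1/2) : ℝ) (1/2), S.θ s x ^ 2 ≤ C * (1 + S.fisher s) :=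
        fun x hxI => (hx x hxI).2.2
      have hN := fun x (hxI : x ∈ Icc (-(1/2) : ℝ) (1/2)) => S.ux_sq_le (t := s) hη0 hxI
      set N := (1 + 1 / η) * tInt (fun y => S.ux s y ^ 2)
        + η * tInt fun y => S.uxx s y ^ 2 with hNdef
      have hN0 : 0 ≤ N := by positivity
      have h1 := S.velocity_estimate A hs hc0 hv hN hQ
      have h2 := S.power_estimate A hs one_pos hc0 hv hN hQ
      have e1 : (tInt fun x => S.θ s x ^ (1 : ℝ)) = tInt (S.θ s) :=
        tInt_congr fun x => rpow_one _
      have e2 : (tInt fun x => S.θ s x ^ ((1 : ℝ) - 1) * S.θx s x ^ 2)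
          = tInt fun x => S.θx s x ^ 2 :=
        tInt_congr fun x => by rw [sub_self, rpow_zero, one_mul]
      rw [e1, e2, one_mul] at h2
      have h3 : L * ((μ ^ 2 * N + R ^ 2 * (C * (1 + S.fisher s))) / c ^ 2)
          * tInt (fun x => S.vx s x ^ 2)
          ≤ L * ((μ ^ 2 * N + R ^ 2 * (C * (1 + S.fisher s))) / c ^ 2) * D := by
        have := hD S hS s hs
        gcongr
      have h4 : ((μ + R) * N + R * (C * (1 + S.fisher s))) / c * tInt (S.θ s)
          ≤ ((μ + R) * N + R * (C * (1 + S.fisher s))) / c * C := by gcongr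
      have h5 := mul_le_mul_of_nonneg_left (h2.trans h4) hK0.le
      have e3 : K * (κ₁ / C) = L * R ^ 2 := by rw [hK]; field_simp
      have e4 : L * ((μ ^ 2 * N + R ^ 2 * (C * (1 + S.fisher s))) / c ^ 2) * D
          + K * (((μ + R) * N + R * (C * (1 + S.fisher s))) / c * C)
          = G * N + (H * C + H * C * S.fisher s) := by rw [hG, hH]; ring
      have e5 : G * N = k * (1 / 2 * tInt (fun x => S.ux s x ^ 2))
          + μ / (4 * C) * tInt (fun x => S.uxx s x ^ 2) := by
        have : G * η = μ / (4 * C) := by rw [hη]; field_simp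
        rw [hNdef, hk, ← this]
        ring
      have e6 : μ / (2 * C) = 2 * (μ / (4 * C)) := by field_simp; norm_num
      have h6 : 0 ≤ k * (K * (R / (γ - 1)) / 2 * tInt fun x => S.θ s x ^ 2) := by
        have := hθ0 s
        positivity
      rw [mul_add, ← mul_assoc K (κ₁ / C), e3] at h5
      rw [e6] at h1
      linarith)
    (fun s hs => by
      rw [intervalIntegral.integral_const, smul_eq_mul, sub_zero]
      have := hs.2
      gcongr)
    (fun s hs => integral_affine_le S.continuous_fisher (by positivity) (by positivity) hs
      (hB S hS s hs).2.2.1)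
  have hbound : ∀ t ∈ Icc 0 T, tInt (fun x => S.ux t x ^ 2) ≤ 2 * Y ∧
      ∫ s in (0 : ℝ)..t, tInt (fun x => S.uxx s x ^ 2) ≤ 4 * C / μ * Y := fun t ht => by
    have h := key t ht
    obtain ⟨-, b1, -, b2, -⟩ := S.initial_bounds A hS
    have h1 : (1 / 2 * tInt (fun x => S.ux 0 x ^ 2)
        + K * (R / (γ - 1)) / 2 * tInt (fun x => S.θ 0 x ^ 2) + (T * (H * C) + H * C * C))
        * Real.exp (T * k) ≤ Y := by
      rw [hY]
      gcongr
    have i0 : 0 ≤ ∫ s in (0 : ℝ)..t, tInt (fun x => S.uxx s x ^ 2) :=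
      intervalIntegral.integral_nonneg ht.1 fun s _ => hB0 s
    rw [intervalIntegral.integral_const_mul] at h
    have p1 : 0 ≤ μ / (4 * C) * ∫ s in (0 : ℝ)..t, tInt (fun x => S.uxx s x ^ 2) := by
      positivity
    have p2 : 0 ≤ K * (R / (γ - 1)) / 2 * tInt fun x => S.θ t x ^ 2 := by
      have := hθ0 t
      positivity
    have p3 := hA0 t
    refine ⟨by linarith, ?_⟩
    have p4 : μ / (4 * C) * ∫ s in (0 : ℝ)..t, tInt (fun x => S.uxx s x ^ 2) ≤ Y := by linarith
    calc _ = 4 * C / μ * (μ / (4 * C) * ∫ s in (0 : ℝ)..t, tInt (fun x => S.uxx s x ^ 2)) := by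
          field_simp
      _ ≤ _ := by gcongr
  refine ⟨fun s => 4 * Y + 1 * tInt fun x => S.uxx s x ^ 2, by fun_prop, fun s => ?_,
    fun t ht => ⟨?_, fun x hx => ?_⟩⟩
  · have := hB0 s
    positivity
  · exact (integral_affine_le hcB (by positivity) zero_le_one ht (hbound t ht).2).trans_eq
      (by ring)
  · have h1 := S.ux_sq_le (t := t) one_pos hx
    have h2 := (hbound t ht).1
    linarith

end Sol

lemma Linf_rpow_le {f : ℝ → ℝ} {p B : ℝ} (hp : 0 < p) (hf : ∀ x, 0 ≤ f x)
    (h : ∀ x ∈ Icc (-(1/2) : ℝ) (1/2), f x ^ p ≤ B) : Linf f ^ p ≤ B := by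
  have hB : 0 ≤ B := (rpow_nonneg (hf 0) p).trans (h 0 (by norm_num))
  have h1 : Linf f ≤ B ^ p⁻¹ := by
    refine Real.sSup_le ?_ (rpow_nonneg hB _)
    rintro _ ⟨x, hx, rfl⟩
    simp only
    rw [abs_of_nonneg (hf x), le_rpow_inv_iff_of_pos (hf x) hB hp]
    exact h x hx
  have h0 : 0 ≤ Linf f := Real.sSup_nonneg (by rintro _ ⟨x, -, rfl⟩; exact abs_nonneg _)
  calc Linf f ^ p ≤ (B ^ p⁻¹) ^ p := rpow_le_rpow h0 h1 hp.le
    _ = B := rpow_inv_rpow hB (ne_of_gt hp)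

/-- A continuous majorant bounds the integral, whether or not the integrand is integrable. -/
lemma integral_le_of_le {f g : ℝ → ℝ} {t C : ℝ} (ht : 0 ≤ t) (hg : Continuous g) (hC : 0 ≤ C)
    (hfg : ∀ s ∈ Icc 0 t, f s ≤ g s) (h : ∫ s in (0 : ℝ)..t, g s ≤ C) :
    ∫ s in (0 : ℝ)..t, f s ≤ C := by
  by_cases hf : IntervalIntegrable f volume 0 t
  · exact (intervalIntegral.integral_mono_on ht hf (hg.intervalIntegrable _ _) hfg).trans h
  · rwa [intervalIntegral.integral_undef hf]

namespace Sol

variable {μ R a b κ₁ κ₂ β γ T M ε : ℝ}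

/-! ### Moments of the temperature -/

theorem moment_bound (A : Admissible μ R a b κ₁ κ₂ β γ T M ε) {r : ℝ} (hr : 0 < r) :
    ∃ C : ℝ, 0 < C ∧ ∀ S : Sol μ R a b κ₁ κ₂ β γ T, S.Bounded M ε → ∀ t ∈ Icc (0 : ℝ) T,
      tInt (fun x => S.θ t x ^ (r + 1)) ≤ C ∧
      ∫ s in (0 : ℝ)..t, tInt (fun x => S.θ s x ^ (r - 1) * S.θx s x ^ 2) ≤ C := by
  obtain ⟨c, C, hc0, hC0, hB⟩ := basic_bounds A
  obtain ⟨D, hD0, hD⟩ := ux_bound A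
  have hμ := A.μ_pos
  have hR := A.R_pos
  have hκ₁ := A.κ₁_pos
  have hT := A.T_pos
  have hcv := cv_pos A
  set H := T * (R * C / c) + R * C / c * C + (μ + R) / c * D with hH
  have hH0 : 0 < H := by positivity
  set e := R / (γ - 1) / (r + 1) with he
  have he0 : 0 < e := by positivity
  set Y := (e * (2 + 2 * M ^ 2) ^ (r + 1) + H) * Real.exp (1 / e * H) with hY
  have hY0 : 0 < Y := by positivity
  refine ⟨1 / e * Y + C / (r * κ₁) * Y, by positivity, fun S hS t ht => ?_⟩
  obtain ⟨N, hNc, hN0, hN⟩ := hD S hS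
  set P : ℝ → ℝ := fun s => R * C / c + R * C / c * S.fisher s + (μ + R) / c * N s with hP
  have hPc : Continuous P := by
    have := S.continuous_fisher
    fun_prop
  have hP0 : ∀ s, 0 ≤ P s := fun s => by
    have := S.fisher_nonneg s
    have := hN0 s
    positivity
  have hPI : ∀ s ∈ Icc 0 T, ∫ z in (0 : ℝ)..s, P z ≤ H := fun s hs => by
    have h1 := integral_affine_le S.continuous_fisher (c := R * C / c) (d := R * C / c)
      (by positivity) (by positivity) hs (hB S hS s hs).2.2.1
    have h2 : (μ + R) / c * ∫ z in (0 : ℝ)..s, N z ≤ (μ + R) / c * D :=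
      mul_le_mul_of_nonneg_left (hN s hs).1 (by positivity)
    have hfc := S.continuous_fisher
    rw [hP, intervalIntegral.integral_add
      (Continuous.intervalIntegrable (by fun_prop) _ _)
      ((hNc.const_mul _).intervalIntegrable _ _), intervalIntegral.integral_const_mul ((μ + R) / c)]
    linarith
  have hcD : Continuous fun s => tInt fun x => S.θ s x ^ (r - 1) * S.θx s x ^ 2 :=
    continuous_tInt (F := fun s x => S.θ s x ^ (r - 1) * S.θx s x ^ 2) (by fun_prop)
  have hD0 : ∀ s, 0 ≤ tInt fun x => S.θ s x ^ (r - 1) * S.θx s x ^ 2 := fun s =>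
    tInt_nonneg fun x => mul_nonneg (rpow_nonneg (S.θ_pos s x).le _) (sq_nonneg _)
  have hm0 : ∀ s, 0 ≤ tInt fun x => S.θ s x ^ (r + 1) := fun s =>
    tInt_nonneg fun x => rpow_nonneg (S.θ_pos s x).le _
  have key := gronwall_dissip (y := fun s => e * tInt fun x => S.θ s x ^ (r + 1))
    (y' := fun s => R / (γ - 1) * tInt fun x => S.θt s x * S.θ s x ^ r)
    (D := fun s => r * (κ₁ / C) * tInt fun x => S.θ s x ^ (r - 1) * S.θx s x ^ 2)
    (k := fun s => 1 / e * P s) (h := P) (T := T) (K := 1 / e * H) (H := H)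
    (fun s _ => by
      refine ((hasDerivAt_tInt (F := fun s x => S.θ s x ^ (r + 1))
        (F' := fun s x => (r + 1) * (S.θt s x * S.θ s x ^ r)) (by fun_prop) (by fun_prop)
        (fun s x => (S.hasDerivAt_θ_rpow_t s x (r + 1)).congr_deriv
          (by rw [add_sub_cancel_right]; ring)) s).const_mul e).congr_deriv ?_
      rw [tInt_const_mul, he]
      field_simp)
    (hcD.const_mul _) (hPc.const_mul _) hPc
    (fun s => mul_nonneg (by positivity) (hD0 s))
    (fun s => mul_nonneg (by positivity) (hP0 s)) hP0
    (mul_nonneg he0.le (hm0 0))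
    (fun s hs => by
      obtain ⟨-, -, -, hx⟩ := hB S hS s hs
      have h1 := S.power_estimate A hs hr hc0 (V := C)
        (fun x hxI => ⟨(hx x hxI).1, (hx x hxI).2.1⟩) (hN s hs).2 fun x hxI => (hx x hxI).2.2
      have h2 : tInt (fun x => S.θ s x ^ r) ≤ 1 + tInt fun x => S.θ s x ^ (r + 1) := by
        rw [← tInt_const 1, ← tInt_add (by fun_prop) (by fun_prop)]
        exact tInt_mono (by fun_prop) (by fun_prop) fun x _ => by
          simpa [tInt_const] using S.θ_rpow_le_one_add s x hr.le (by linarith : r ≤ r + 1)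
      have h3 : ((μ + R) * N s + R * (C * (1 + S.fisher s))) / c = P s := by
        rw [hP]; ring
      rw [h3] at h1
      have h4 := mul_le_mul_of_nonneg_left h2 (hP0 s)
      have h5 : 1 / e * P s * (e * tInt fun x => S.θ s x ^ (r + 1))
          = P s * tInt fun x => S.θ s x ^ (r + 1) := by field_simp
      rw [h5]
      linarith)
    (fun s hs => by
      rw [intervalIntegral.integral_const_mul]
      have := hPI s hs
      gcongr)
    hPI t ht
  have h0 : (e * tInt (fun x => S.θ 0 x ^ (r + 1)) + H) * Real.exp (1 / e * H) ≤ Y := by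
    have : tInt (fun x => S.θ 0 x ^ (r + 1)) ≤ (2 + 2 * M ^ 2) ^ (r + 1) := by
      rw [← tInt_const ((2 + 2 * M ^ 2) ^ (r + 1))]
      exact tInt_mono (by fun_prop) continuous_const fun x hx =>
        rpow_le_rpow (S.θ_pos 0 x).le (S.initial_θ_le A hS hx) (by linarith)
    rw [hY]
    gcongr
  rw [intervalIntegral.integral_const_mul] at key
  have i0 : 0 ≤ ∫ s in (0 : ℝ)..t, tInt fun x => S.θ s x ^ (r - 1) * S.θx s x ^ 2 :=
    intervalIntegral.integral_nonneg ht.1 fun s _ => hD0 s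
  have i1 : 0 ≤ r * (κ₁ / C) * ∫ s in (0 : ℝ)..t,
      tInt fun x => S.θ s x ^ (r - 1) * S.θx s x ^ 2 := by positivity
  have i2 : 0 ≤ e * tInt fun x => S.θ t x ^ (r + 1) := mul_nonneg he0.le (hm0 t)
  have q1 : 0 ≤ 1 / e * Y := by positivity
  have q2 : 0 ≤ C / (r * κ₁) * Y := by positivity
  constructor
  · have h1 : e * (tInt fun x => S.θ t x ^ (r + 1)) ≤ Y := by linarith
    have h2 := mul_le_mul_of_nonneg_left h1 (one_div_pos.2 he0).le
    rw [← mul_assoc, one_div_mul_cancel he0.ne', one_mul] at h2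
    linarith
  · have h1 : r * (κ₁ / C) * ∫ s in (0 : ℝ)..t,
        tInt (fun x => S.θ s x ^ (r - 1) * S.θx s x ^ 2) ≤ Y := by linarith
    have h2 := mul_le_mul_of_nonneg_left h1 (by positivity : 0 ≤ C / (r * κ₁))
    have h3 : C / (r * κ₁) * (r * (κ₁ / C)) = 1 := by field_simp
    rw [← mul_assoc, h3, one_mul] at h2
    linarith

/-- The time integral of the `p`-th power of the maximal temperature is bounded. -/
theorem Linf_θ_bound (A : Admissible μ R a b κ₁ κ₂ β γ T M ε) {p : ℝ} (hp : 0 < p) :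
    ∃ C : ℝ, 0 < C ∧ ∀ S : Sol μ R a b κ₁ κ₂ β γ T, S.Bounded M ε → ∀ t ∈ Icc (0 : ℝ) T,
      ∫ s in (0 : ℝ)..t, Linf (S.θ s) ^ p ≤ C := by
  obtain ⟨E, hE0, hE⟩ := energy_bound A
  obtain ⟨D, hD0, hD⟩ := moment_bound A hp
  have hT := A.T_pos
  set L := 1 + E ^ (p + 1) + (p + 1) ^ 2 / (4 * 1) * D with hL
  have hL0 : 0 < L := by positivity
  refine ⟨T * L + 1 * D, by positivity, fun S hS t ht => ?_⟩
  have hcD : Continuous fun s => tInt fun x => S.θ s x ^ (p - 1) * S.θx s x ^ 2 :=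
    continuous_tInt (F := fun s x => S.θ s x ^ (p - 1) * S.θx s x ^ 2) (by fun_prop)
  refine integral_le_of_le ht.1 (continuous_const.add (hcD.const_mul 1)) (by positivity)
    (fun s hs => ?_)
    (integral_affine_le hcD hL0.le zero_le_one ht (hD S hS t ht).2)
  have hs' : s ∈ Icc 0 T := ⟨hs.1, hs.2.trans ht.2⟩
  refine Linf_rpow_le hp (fun x => (S.θ_pos s x).le) fun x hx => ?_
  have h1 := S.θ_rpow_le_one_add s x hp.le (by linarith : p ≤ p + 1)
  have h2 := S.θ_rpow_le s (by linarith : 0 ≤ p + 1) one_pos (p - 1) hx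
  rw [show 2 * (p + 1 - 1) - (p - 1) = p + 1 by ring] at h2
  have h3 : tInt (S.θ s) ^ (p + 1) ≤ E ^ (p + 1) :=
    rpow_le_rpow (tInt_nonneg fun y => (S.θ_pos s y).le) (hE S hS s hs').1 (by linarith)
  have h4 : (p + 1) ^ 2 / (4 * 1) * tInt (fun y => S.θ s y ^ (p + 1))
      ≤ (p + 1) ^ 2 / (4 * 1) * D := by
    have := (hD S hS s hs').1
    gcongr
  change S.θ s x ^ p ≤ L + 1 * tInt fun y => S.θ s y ^ (p - 1) * S.θx s y ^ 2
  linarith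

lemma Y_nonneg (S : Sol μ R a b κ₁ κ₂ β γ T) (t : ℝ) : 0 ≤ S.Y t := by
  refine Real.sSup_nonneg ?_
  rintro _ ⟨s, -, rfl⟩
  exact tInt_nonneg fun x => by positivity

end Sol

end RadHydro

theorem stmt_10 (μ R a b κ₁ κ₂ β γ : ℝ)
    (hμ : 0 < μ) (hR : 0 < R) (ha : 0 < a) (hb : 0 < b)
    (hκ₁ : 0 < κ₁) (hκ₂ : 0 < κ₂) (hβ : 0 < β) (hγ : 1 < γ)
    (T M ε : ℝ) (hT : 0 < T) (hM : 1 ≤ M) (hε0 : 0 < ε) (hε1 : ε ≤ 1)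
    (p n : ℝ) (hp : 1 ≤ p) (hnp : p ≤ n) :
    ∃ C : ℝ, 0 < C ∧
      ∀ S : Sol μ R a b κ₁ κ₂ β γ T, S.Bounded M ε →
        ∀ t ∈ Icc (0 : ℝ) T,
          (∫ s in (0 : ℝ)..t, Linf (S.θ s) ^ p) ≤ C * (1 + S.Y t ^ T0 n p β) := by
  obtain ⟨C, hC0, hC⟩ := Sol.Linf_θ_bound
    (⟨hμ, hR, ha, hb, hκ₁, hκ₂, hβ, hγ, hT, hM, hε0⟩ : Admissible μ R a b κ₁ κ₂ β γ T M ε)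
    (by linarith : 0 < p)
  refine ⟨C, hC0, fun S hS t ht => (hC S hS t ht).trans ?_⟩
  have := Real.rpow_nonneg (S.Y_nonneg t) (T0 n p β)
  nlinarith
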